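/- arXiv:1805.05224 — 4 statements merged into one kernel-verified Lean document; each statement's English description precedes it below -/
import Mathlib

section
/- For every positive integer k and every ε > 0 there exists n₀ such that for all n > n₀, | 2^{−nk} · E_{f ∈ 𝓕ₙ}[ gap(f)^{2k} ] − (2k−1)!! | ≤ ε, where (2k−1)!! = 1·3·5⋯(2k−1) and the expectation is over a uniformly random f ∈ 𝓕ₙ. Equivalently, the 2k-th moment of gap(f)/2ⁿ approaches that of a Gaussian with mean 0 and variance 2^{−n}. -/
/-- The gap of a Boolean function on a finite domain:
`gap f = ∑_x (−1)^{f(x)}`, i.e. `+1` for each `x` with `f x = 0` and `−1` otherwise. -/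
def gap {σ : Type*} [Fintype σ] (f : σ → ZMod 2) : ℤ :=
  ∑ x : σ, if f x = 0 then 1 else -1

/-- Index set of monomials of a degree-≤3 polynomial over 𝔽₂ in `n` variables with no
constant term: nonempty subsets of the variables of size at most 3. -/
abbrev MonIdx (n : ℕ) := {S : Finset (Fin n) // S.Nonempty ∧ S.card ≤ 3}

/-- A coefficient assignment, i.e. an element of 𝓕ₙ: a polynomial over 𝔽₂ in `n` variables
of total degree ≤ 3 with zero constant term, recorded by its (multilinear) coefficients. -/
abbrev Coeffs (n : ℕ) := MonIdx n → ZMod 2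

/-- The Boolean function `𝔽₂ⁿ → 𝔽₂` evaluated by the polynomial with coefficients `α`. -/
def polyFun {n : ℕ} (α : Coeffs n) : (Fin n → ZMod 2) → ZMod 2 :=
  fun z => ∑ S : MonIdx n, α S * ∏ i ∈ S.1, z i

/-- The number of maps with prescribed fibre sizes is a multinomial coefficient. -/
theorem card_filter_card_fiber_eq {V : Type*} [Fintype V] [DecidableEq V] {m : ℕ} (d : V → ℕ)
    (hd : ∑ v, d v = m) :
    (Finset.univ.filter fun z : Fin m → V =>
      ∀ v, (Finset.univ.filter fun j => z j = v).card = d v).card =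
      Nat.multinomial Finset.univ d := by
  have h := MvPolynomial.coeff_sum_X_pow_of_fintype (R := ℕ) (Finsupp.equivFunOnFinite.symm d) m
  rw [Fintype.sum_pow, MvPolynomial.coeff_sum] at h
  have hs : ((Finsupp.equivFunOnFinite.symm d).sum fun _ a => a) = m := by
    rw [Finsupp.sum_fintype _ _ (by simp)]; simpa using hd
  have hprod : ∀ z : Fin m → V, ∏ i, (MvPolynomial.X (z i) : MvPolynomial V ℕ) =
      MvPolynomial.monomial (∑ i, Finsupp.single (z i) 1) 1 := by
    intro z
    rw [MvPolynomial.monomial_sum_one]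
    rfl
  simp only [hprod, MvPolynomial.coeff_monomial] at h
  rw [if_pos (by simpa [Finsupp.sum_fintype] using hd),
    ← Finsupp.multinomial_of_support_subset (Finset.subset_univ _)] at h
  simp only [Finset.sum_boole, Nat.cast_id] at h
  rw [← Finsupp.coe_equivFunOnFinite_symm d, ← h]
  congr 1
  ext z
  simp only [Finset.mem_filter, Finset.mem_univ, true_and, Finsupp.ext_iff]
  refine forall_congr' fun v => ?_
  simp [Finsupp.finsetSum_apply, Finsupp.single_apply]

/-- The number of maps `Fin (2 * k) → V` all of whose nonempty fibres have exactly two elements. -/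
theorem card_filter_card_fiber_eq_zero_or_two (V : Type*) [Fintype V] [DecidableEq V] (k : ℕ) :
    (Finset.univ.filter fun z : Fin (2 * k) → V =>
      ∀ v, (Finset.univ.filter fun j => z j = v).card = 0 ∨
        (Finset.univ.filter fun j => z j = v).card = 2).card * 2 ^ k =
      (Fintype.card V).choose k * (2 * k).factorial := by
  have hT : ∀ T ∈ Finset.powersetCard k (Finset.univ : Finset V),
      (Finset.univ.filter fun z : Fin (2 * k) → V =>
        ∀ v, (Finset.univ.filter fun j => z j = v).card = if v ∈ T then 2 else 0).card * 2 ^ k =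
      (2 * k).factorial := by
    intro T hT
    have hc := (Finset.mem_powersetCard.1 hT).2
    have hsum : ∑ v, (if v ∈ T then 2 else 0) = 2 * k := by
      simp [hc, mul_comm]
    rw [card_filter_card_fiber_eq _ hsum, ← hsum, ← Nat.multinomial_spec, mul_comm]
    congr 1
    have : ∀ v, (if v ∈ T then 2 else 0).factorial = if v ∈ T then 2 else 1 := by
      intro v; split_ifs <;> rfl
    simp only [this, Finset.prod_ite_mem, Finset.univ_inter, Finset.prod_const, hc]
  have hU : (Finset.univ.filter fun z : Fin (2 * k) → V =>
      ∀ v, (Finset.univ.filter fun j => z j = v).card = 0 ∨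
        (Finset.univ.filter fun j => z j = v).card = 2) =
      (Finset.powersetCard k (Finset.univ : Finset V)).biUnion fun T =>
        Finset.univ.filter fun z : Fin (2 * k) → V =>
        ∀ v, (Finset.univ.filter fun j => z j = v).card = if v ∈ T then 2 else 0 := by
    ext z
    simp only [Finset.mem_filter, Finset.mem_univ, true_and, Finset.mem_biUnion,
      Finset.mem_powersetCard, Finset.subset_univ]
    constructor
    · intro h
      have hv : ∀ v, (Finset.univ.filter fun j => z j = v).card =
          if v ∈ Finset.univ.filter (fun v => (Finset.univ.filter fun j => z j = v).card = 2)
          then 2 else 0 := by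
        intro v
        rcases h v with h | h <;> simp [h]
      refine ⟨Finset.univ.filter fun v => (Finset.univ.filter fun j => z j = v).card = 2, ?_, hv⟩
      have := Finset.card_eq_sum_card_fiberwise (s := Finset.univ) (t := Finset.univ) (f := z)
        (by simp)
      rw [Finset.sum_congr rfl fun v _ => hv v] at this
      simp only [Finset.sum_ite_mem, Finset.univ_inter, Finset.sum_const, Finset.card_univ,
        Fintype.card_fin, smul_eq_mul] at this
      omega
    · rintro ⟨T, -, h⟩ v
      rw [h v]
      split_ifs <;> simp
  rw [hU, Finset.card_biUnion, Finset.sum_mul, Finset.sum_congr rfl hT]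
  · simp
  · intro T _ T' _ hne
    refine Finset.disjoint_left.2 fun z h h' => hne ?_
    simp only [Finset.mem_filter, Finset.mem_univ, true_and] at h h'
    ext v
    have := (h v).symm.trans (h' v)
    split_ifs at this <;> simp_all

/-- The `±1`-valued character of `ZMod 2`. -/
def signChar (a : ZMod 2) : ℝ := if a = 0 then 1 else -1

theorem signChar_add : ∀ a b : ZMod 2, signChar (a + b) = signChar a * signChar b := by
  have h1 : (1 : ZMod 2) ≠ 0 := by decide
  have h2 : (1 + 1 : ZMod 2) = 0 := by decide
  have hz : ∀ a : ZMod 2, a = 0 ∨ a = 1 := by decide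
  intro a b
  rcases hz a with rfl | rfl <;> rcases hz b with rfl | rfl <;> simp [signChar, h1, h2]

theorem signChar_sum {ι : Type*} (s : Finset ι) (f : ι → ZMod 2) :
    signChar (∑ i ∈ s, f i) = ∏ i ∈ s, signChar (f i) := by
  classical
  induction s using Finset.induction_on with
  | empty => simp [signChar]
  | insert a s ha ih => rw [Finset.sum_insert ha, Finset.prod_insert ha, signChar_add, ih]

theorem sum_signChar_mul (w : ZMod 2) :
    ∑ a : ZMod 2, signChar (a * w) = if w = 0 then 2 else 0 := by
  have h1 : (1 : ZMod 2) ≠ 0 := by decide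
  have hz : ∀ a : ZMod 2, a = 0 ∨ a = 1 := by decide
  have hu : (Finset.univ : Finset (ZMod 2)) = {0, 1} := by decide
  rw [hu, Finset.sum_pair h1.symm]
  rcases hz w with rfl | rfl <;> norm_num [signChar, h1]

/-- Orthogonality of characters of `κ → ZMod 2`. -/
theorem sum_signChar_dotProduct {κ : Type*} [Fintype κ] [DecidableEq κ] (w : κ → ZMod 2) :
    ∑ α : κ → ZMod 2, signChar (∑ S, α S * w S) =
      if w = 0 then (Fintype.card (κ → ZMod 2) : ℝ) else 0 := by
  simp only [signChar_sum]
  rw [← Fintype.prod_sum fun (S : κ) (a : ZMod 2) => signChar (a * w S)]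
  simp only [sum_signChar_mul]
  split_ifs with h
  · simp [h]
  · obtain ⟨S, hS⟩ := Function.ne_iff.1 h
    exact Finset.prod_eq_zero (Finset.mem_univ S) (if_neg hS)

/-- All nonconstant monomials of degree at most three sum to zero over the tuple `z`. -/
def CubicVanishing {ι : Type*} [Fintype ι] {n : ℕ} (z : ι → Fin n → ZMod 2) : Prop :=
  ∀ S : MonIdx n, ∑ j, ∏ i ∈ S.1, z j i = 0

open Classical in
/-- The moments of the gap count the tuples with vanishing cubic monomials. -/
theorem moment_gap_eq_card (n m : ℕ) :
    (∑ α : Coeffs n, (gap (polyFun α) : ℝ) ^ m) / Fintype.card (Coeffs n) =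
      (Finset.univ.filter fun z : Fin m → Fin n → ZMod 2 => CubicVanishing z).card := by
  have hg : ∀ α : Coeffs n, (gap (polyFun α) : ℝ) = ∑ x, signChar (polyFun α x) := by
    intro α
    simp [gap, signChar]
  have hz : ∀ (z : Fin m → Fin n → ZMod 2) (α : Coeffs n), ∏ j, signChar (polyFun α (z j)) =
      signChar (∑ S, α S * ∑ j, ∏ i ∈ S.1, z j i) := by
    intro z α
    rw [← signChar_sum]
    simp only [polyFun, Finset.mul_sum]
    rw [Finset.sum_comm]
  rw [div_eq_iff (by positivity)]
  simp only [hg, Fintype.sum_pow, hz]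
  rw [Finset.sum_comm]
  simp only [sum_signChar_dotProduct]
  rw [← Finset.sum_filter, Finset.sum_const, nsmul_eq_mul]
  congr 3
  ext z
  simp [CubicVanishing, funext_iff]

/-- Products of `ZMod 2`-valued functions over finsets are multiplicative under unions. -/
theorem prod_mul_prod_eq_prod_union {κ : Type*} [DecidableEq κ] (x : κ → ZMod 2) (S T : Finset κ) :
    (∏ i ∈ S, x i) * ∏ i ∈ T, x i = ∏ i ∈ S ∪ T, x i := by
  have hx : ∀ i, x i = if x i = 1 then 1 else 0 := by
    intro i
    generalize x i = a
    revert a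
    decide
  have h : ∀ S : Finset κ, ∏ i ∈ S, x i = if ∀ i ∈ S, x i = 1 then 1 else 0 := by
    intro S
    rw [Finset.prod_congr rfl fun i _ => hx i, Finset.prod_ite_zero, Finset.prod_const_one]
  simp only [h, Finset.mem_union, or_imp, forall_and]
  clear hx h
  split_ifs <;> simp_all

/-- The span of the constant one vector and the coordinate vectors of the tuple `z`. -/
def coordSpan {ι : Type*} {n : ℕ} (z : ι → Fin n → ZMod 2) : Submodule (ZMod 2) (ι → ZMod 2) :=
  Submodule.span (ZMod 2) (insert 1 (Set.range fun i j => z j i))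

section

variable {ι : Type*} {n : ℕ} (z : ι → Fin n → ZMod 2)

theorem one_mem_coordSpan : (1 : ι → ZMod 2) ∈ coordSpan z :=
  Submodule.subset_span (Set.mem_insert _ _)

theorem coord_mem_coordSpan (i : Fin n) : (fun j => z j i) ∈ coordSpan z :=
  Submodule.subset_span (Set.mem_insert_of_mem _ ⟨i, rfl⟩)

variable [Fintype ι]

variable {z} in
/-- A trilinear identity on `coordSpan z` forced by the vanishing of cubic monomials. -/
theorem CubicVanishing.sum_mul_mul_eq_zero (hι : Even (Fintype.card ι)) (hz : CubicVanishing z)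
    {a b c : ι → ZMod 2} (ha : a ∈ coordSpan z) (hb : b ∈ coordSpan z) (hc : c ∈ coordSpan z) :
    ∑ j, a j * b j * c j = 0 := by
  have hgen : ∀ a ∈ insert 1 (Set.range fun i j => z j i),
      ∃ S : Finset (Fin n), S.card ≤ 1 ∧ a = fun j => ∏ i ∈ S, z j i := by
    rintro a (rfl | ⟨i, rfl⟩)
    · exact ⟨∅, by simp, by ext; simp⟩
    · exact ⟨{i}, by simp, by ext; simp⟩
  induction ha using Submodule.span_induction with
  | zero => simp
  | add x y _ _ hx hy => simp [add_mul, Finset.sum_add_distrib, hx, hy]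
  | smul r x _ hx => simp [mul_assoc, ← Finset.mul_sum] at hx ⊢; simp [hx]
  | mem a ha =>
  induction hb using Submodule.span_induction with
  | zero => simp
  | add x y _ _ hx hy => simp [add_mul, mul_add, Finset.sum_add_distrib, hx, hy]
  | smul r x _ hx =>
    simp only [Pi.smul_apply, smul_eq_mul, mul_left_comm _ r, mul_assoc, ← Finset.mul_sum] at hx ⊢
    simp [hx]
  | mem b hb =>
  induction hc using Submodule.span_induction with
  | zero => simp
  | add x y _ _ hx hy => simp [mul_add, Finset.sum_add_distrib, hx, hy]
  | smul r x _ hx =>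
    simp only [Pi.smul_apply, smul_eq_mul, mul_left_comm _ r, ← Finset.mul_sum]
    simp [hx]
  | mem c hc =>
  obtain ⟨S, hS, rfl⟩ := hgen a ha
  obtain ⟨T, hT, rfl⟩ := hgen b hb
  obtain ⟨U, hU, rfl⟩ := hgen c hc
  simp only [prod_mul_prod_eq_prod_union]
  rcases (S ∪ T ∪ U).eq_empty_or_nonempty with h | h
  · simpa [h] using (ZMod.natCast_eq_zero_iff_even).2 hι
  · have h1 := Finset.card_union_le (S ∪ T) U
    have h2 := Finset.card_union_le S T
    exact hz ⟨S ∪ T ∪ U, h, by omega⟩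

theorem nondegenerate_dotProductBilin (K : Type*) [Field K] :
    (dotProductBilin K K : LinearMap.BilinForm K (ι → K)).Nondegenerate := by
  constructor
  · intro v h
    exact dotProduct_eq_zero v h
  · intro v h
    exact dotProduct_eq_zero v fun w => (dotProduct_comm v w).trans (h w)

theorem finrank_coordSpan_le_card_image [DecidableEq (Fin n → ZMod 2)] :
    Module.finrank (ZMod 2) (coordSpan z) ≤ (Finset.univ.image z).card := by
  let φ : (Finset.univ.image z → ZMod 2) →ₗ[ZMod 2] (ι → ZMod 2) :=
    LinearMap.funLeft (ZMod 2) (ZMod 2) fun j =>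
      ⟨z j, Finset.mem_image_of_mem z (Finset.mem_univ j)⟩
  have h : coordSpan z ≤ LinearMap.range φ := by
    refine Submodule.span_le.2 ?_
    rintro _ (rfl | ⟨i, rfl⟩)
    · exact ⟨1, rfl⟩
    · exact ⟨fun v => v.1 i, rfl⟩
  refine (Submodule.finrank_mono h).trans ((LinearMap.finrank_range_le φ).trans ?_)
  rw [Module.finrank_fintype_fun_eq_card, Fintype.card_coe]

variable {z}

/-- Vanishing cubic monomials make `coordSpan z` self-orthogonal, and closed under products when
it has maximal dimension. -/
theorem CubicVanishing.finrank_coordSpan_le {k : ℕ} (hι : Fintype.card ι = 2 * k)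
    (hz : CubicVanishing z) : Module.finrank (ZMod 2) (coordSpan z) ≤ k ∧
      (Module.finrank (ZMod 2) (coordSpan z) = k →
        ∀ a ∈ coordSpan z, ∀ b ∈ coordSpan z, a * b ∈ coordSpan z) := by
  have he : Even (Fintype.card ι) := ⟨k, by omega⟩
  let B : LinearMap.BilinForm (ZMod 2) (ι → ZMod 2) := dotProductBilin (ZMod 2) (ZMod 2)
  have hmul : ∀ a ∈ coordSpan z, ∀ b ∈ coordSpan z, a * b ∈ B.orthogonal (coordSpan z) := by
    intro a ha b hb
    rw [LinearMap.BilinForm.mem_orthogonal_iff]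
    intro c hc
    change ∑ j, c j * (a j * b j) = 0
    simpa only [mul_assoc] using hz.sum_mul_mul_eq_zero he hc ha hb
  have hle : coordSpan z ≤ B.orthogonal (coordSpan z) := fun a ha => by
    simpa using hmul a ha 1 (one_mem_coordSpan z)
  have hrank : Module.finrank (ZMod 2) (B.orthogonal (coordSpan z)) = _ :=
    LinearMap.BilinForm.finrank_orthogonal (nondegenerate_dotProductBilin (ZMod 2)) (coordSpan z)
  rw [Module.finrank_fintype_fun_eq_card, hι] at hrank
  have := Submodule.finrank_mono hle
  refine ⟨by omega, fun hk a ha b hb => ?_⟩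
  rw [Submodule.eq_of_le_of_finrank_eq hle (by omega)]
  exact hmul a ha b hb

/-- A tuple with vanishing cubic monomials either spans a low-dimensional space, or takes each
of its values exactly twice. -/
theorem CubicVanishing.finrank_lt_or_card_fiber {k : ℕ} (hι : Fintype.card ι = 2 * k)
    (hz : CubicVanishing z) : Module.finrank (ZMod 2) (coordSpan z) < k ∨
      ∀ v, (Finset.univ.filter fun j => z j = v).card = 0 ∨
        (Finset.univ.filter fun j => z j = v).card = 2 := by
  have he : Even (Fintype.card ι) := ⟨k, by omega⟩
  obtain ⟨hle, hmul⟩ := hz.finrank_coordSpan_le hι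
  refine hle.lt_or_eq.imp_right fun hk => ?_
  specialize hmul hk
  have hprod : ∀ (s : Finset (Fin n)) (f : Fin n → ι → ZMod 2), (∀ i, f i ∈ coordSpan z) →
      ∏ i ∈ s, f i ∈ coordSpan z := by
    intro s f hf
    induction s using Finset.induction_on with
    | empty => simpa using one_mem_coordSpan z
    | insert a s ha ih =>
      rw [Finset.prod_insert ha]
      exact hmul _ (hf a) _ ih
  have heven : ∀ v, Even (Finset.univ.filter fun j => z j = v).card := by
    intro v
    have hmem := hprod Finset.univ (fun i => (fun j => z j i) + (v i + 1) • 1) fun i =>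
      add_mem (coord_mem_coordSpan z i) (Submodule.smul_mem _ _ (one_mem_coordSpan z))
    have hsum := hz.sum_mul_mul_eq_zero he hmem (one_mem_coordSpan z) (one_mem_coordSpan z)
    have hind : ∀ a b : ZMod 2, a + (b + 1) = if a = b then 1 else 0 := by decide
    rw [← ZMod.natCast_eq_zero_iff_even, ← hsum, Finset.card_filter, Nat.cast_sum]
    refine Finset.sum_congr rfl fun j _ => ?_
    simp [Finset.prod_apply, hind, Finset.prod_ite_zero, funext_iff]
  have hpos : ∀ v ∈ Finset.univ.image z, 2 ≤ (Finset.univ.filter fun j => z j = v).card := by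
    intro v hv
    obtain ⟨j, -, rfl⟩ := Finset.mem_image.1 hv
    have : 0 < (Finset.univ.filter fun j' => z j' = z j).card :=
      Finset.card_pos.2 ⟨j, by simp⟩
    obtain ⟨c, hc⟩ := heven (z j)
    omega
  have htotal := Finset.card_eq_sum_card_image z Finset.univ
  have himage := finrank_coordSpan_le_card_image z
  intro v
  by_cases hv : v ∈ Finset.univ.image z
  · right
    have heq : ∑ v ∈ Finset.univ.image z, 2 =
        ∑ v ∈ Finset.univ.image z, (Finset.univ.filter fun j => z j = v).card := by
      refine le_antisymm (Finset.sum_le_sum hpos) ?_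
      rw [← htotal, Finset.card_univ, Finset.sum_const, smul_eq_mul]
      omega
    exact ((Finset.sum_eq_sum_iff_of_le hpos).1 heq v hv).symm
  · left
    rw [Finset.card_eq_zero, Finset.filter_eq_empty_iff]
    exact fun j _ hj => hv (hj ▸ Finset.mem_image_of_mem z (Finset.mem_univ j))

theorem cubicVanishing_of_card_fiber
    (h : ∀ v, (Finset.univ.filter fun j => z j = v).card = 0 ∨
      (Finset.univ.filter fun j => z j = v).card = 2) : CubicVanishing z := by
  intro S
  rw [← Finset.sum_fiberwise Finset.univ z]
  refine Finset.sum_eq_zero fun v _ => ?_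
  rw [Finset.sum_congr rfl (g := fun _ => ∏ i ∈ S.1, v i), Finset.sum_const, nsmul_eq_mul]
  · have : (((Finset.univ.filter fun j => z j = v).card : ℕ) : ZMod 2) = 0 := by
      rcases h v with h | h <;> rw [h]
      · simp
      · decide
    rw [this, zero_mul]
  · intro j hj
    rw [(Finset.mem_filter.1 hj).2]

end

open Classical in
/-- Few tuples span a low-dimensional space. -/
theorem card_filter_finrank_coordSpan_lt_le (m n k : ℕ) :
    (Finset.univ.filter fun z : Fin m → Fin n → ZMod 2 =>
      Module.finrank (ZMod 2) (coordSpan z) < k).card ≤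
      Nat.card (Submodule (ZMod 2) (Fin m → ZMod 2)) * (2 ^ (k - 1)) ^ n := by
  have : Fintype (Submodule (ZMod 2) (Fin m → ZMod 2)) := Fintype.ofFinite _
  rw [Nat.card_eq_fintype_card, ← Finset.card_univ, ← smul_eq_mul]
  refine le_trans (Finset.card_le_card_of_injOn
    (t := Finset.univ.sigma fun C : Submodule (ZMod 2) (Fin m → ZMod 2) =>
      Finset.univ.filter fun r : Fin n → Fin m → ZMod 2 =>
        Module.finrank (ZMod 2) C < k ∧ ∀ i, r i ∈ C)
    (fun z => ⟨coordSpan z, fun i j => z j i⟩) ?_ ?_) ?_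
  · intro z hz
    have := (Finset.mem_filter.1 hz).2
    simpa using ⟨this, coord_mem_coordSpan z⟩
  · intro z _ z' _ h
    simp only [Sigma.mk.injEq, heq_eq_eq] at h
    ext j i
    exact congrFun (congrFun h.2 i) j
  · rw [Finset.card_sigma]
    refine Finset.sum_le_card_nsmul _ _ _ fun C _ => ?_
    by_cases hC : Module.finrank (ZMod 2) C < k
    · have : (Finset.univ.filter fun r : Fin n → Fin m → ZMod 2 =>
          Module.finrank (ZMod 2) C < k ∧ ∀ i, r i ∈ C) =
          Fintype.piFinset fun _ => Finset.univ.filter fun x => x ∈ C := by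
        ext r
        simp [hC]
      rw [this, Fintype.card_piFinset, Finset.prod_const, Finset.card_univ, Fintype.card_fin]
      refine Nat.pow_le_pow_left ?_ n
      rw [← Fintype.card_subtype]
      have hcard : Fintype.card C = 2 ^ Module.finrank (ZMod 2) C := by
        rw [Module.card_eq_pow_finrank (K := ZMod 2), ZMod.card]
      exact hcard.le.trans (Nat.pow_le_pow_right two_pos (by omega))
    · simp [hC]

open Classical in
/-- The number of tuples with vanishing cubic monomials, bounded on both sides by the number of
tuples taking each value zero times or twice. -/
theorem card_cubicVanishing_bounds (n k : ℕ) :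
    ((2 ^ n).choose k * (2 * k).factorial : ℝ) / 2 ^ k ≤
      (Finset.univ.filter fun z : Fin (2 * k) → Fin n → ZMod 2 => CubicVanishing z).card ∧
    ((Finset.univ.filter fun z : Fin (2 * k) → Fin n → ZMod 2 => CubicVanishing z).card : ℝ) ≤
      ((2 ^ n).choose k * (2 * k).factorial : ℝ) / 2 ^ k +
        Nat.card (Submodule (ZMod 2) (Fin (2 * k) → ZMod 2)) * (2 ^ (k - 1)) ^ n := by
  set P := Finset.univ.filter fun z : Fin (2 * k) → Fin n → ZMod 2 =>
      ∀ v, (Finset.univ.filter fun j => z j = v).card = 0 ∨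
        (Finset.univ.filter fun j => z j = v).card = 2 with hP
  have hcard : (P.card : ℝ) = ((2 ^ n).choose k * (2 * k).factorial : ℝ) / 2 ^ k := by
    rw [eq_div_iff (by positivity)]
    have := card_filter_card_fiber_eq_zero_or_two (Fin n → ZMod 2) k
    rw [Fintype.card_fun, ZMod.card, Fintype.card_fin] at this
    rw [hP]
    exact_mod_cast this
  rw [← hcard]
  constructor
  · refine Nat.cast_le.2 (Finset.card_le_card fun z hz => ?_)
    simp only [P, Finset.mem_filter, Finset.mem_univ, true_and] at hz ⊢
    exact cubicVanishing_of_card_fiber hz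
  · have hsub : (Finset.univ.filter fun z : Fin (2 * k) → Fin n → ZMod 2 => CubicVanishing z) ⊆
        P ∪ Finset.univ.filter fun z => Module.finrank (ZMod 2) (coordSpan z) < k := by
      intro z hz
      simp only [P, Finset.mem_filter, Finset.mem_univ, true_and, Finset.mem_union] at hz ⊢
      exact (hz.finrank_lt_or_card_fiber (by simp)).symm
    have h1 := (Finset.card_le_card hsub).trans (Finset.card_union_le _ _)
    have h2 := h1.trans (Nat.add_le_add_left (card_filter_finrank_coordSpan_lt_le (2 * k) n k) _)
    exact_mod_cast h2

theorem factorial_two_mul_eq_prod_odd (k : ℕ) :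
    ((2 * k).factorial : ℝ) / (2 ^ k * k.factorial) = ∏ i ∈ Finset.range k, (2 * (i : ℝ) + 1) := by
  rw [div_eq_iff (by positivity)]
  induction k with
  | zero => simp
  | succ k ih =>
    rw [Finset.prod_range_succ, show 2 * (k + 1) = 2 * k + 1 + 1 by ring, Nat.factorial_succ,
      Nat.factorial_succ, Nat.factorial_succ k]
    push_cast
    rw [ih]
    ring

open Filter Topology in
theorem tendsto_choose_div_pow (k : ℕ) :
    Tendsto (fun N : ℕ => (N.choose k : ℝ) / (N : ℝ) ^ k) atTop (𝓝 (1 / k.factorial)) := by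
  have h := (isEquivalent_choose k).div
    (Asymptotics.IsEquivalent.refl (u := fun N : ℕ => (N : ℝ) ^ k) (l := atTop))
  refine h.symm.tendsto_nhds (tendsto_const_nhds.congr' ?_)
  filter_upwards [eventually_gt_atTop 0] with N hN
  have : (N : ℝ) ≠ 0 := by positivity
  simp only [Pi.div_apply]
  field_simp

open Filter Topology in
open Classical in
theorem tendsto_card_cubicVanishing (k : ℕ) (hk : 1 ≤ k) :
    Tendsto (fun n : ℕ => ((2 : ℝ) ^ (n * k))⁻¹ *
      ((Finset.univ.filter fun z : Fin (2 * k) → Fin n → ZMod 2 => CubicVanishing z).card : ℝ))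
      atTop (𝓝 (∏ i ∈ Finset.range k, (2 * (i : ℝ) + 1))) := by
  have hmain : Tendsto (fun n : ℕ => ((2 : ℝ) ^ (n * k))⁻¹ *
      (((2 ^ n).choose k * (2 * k).factorial : ℝ) / 2 ^ k)) atTop
      (𝓝 (∏ i ∈ Finset.range k, (2 * (i : ℝ) + 1))) := by
    have h := ((tendsto_choose_div_pow k).comp
      (tendsto_pow_atTop_atTop_of_one_lt (r := 2) one_lt_two)).mul_const
      (((2 * k).factorial : ℝ) / 2 ^ k)
    rw [← factorial_two_mul_eq_prod_odd]
    refine (h.congr fun n => ?_).trans_eq ?_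
    · simp only [Function.comp, Nat.cast_pow, Nat.cast_ofNat, pow_mul]
      ring
    · congr 1
      field_simp
  set B : ℝ := (Nat.card (Submodule (ZMod 2) (Fin (2 * k) → ZMod 2)) : ℝ)
  have herr : Tendsto (fun n : ℕ => ((2 : ℝ) ^ (n * k))⁻¹ * (B * (2 ^ (k - 1)) ^ n)) atTop
      (𝓝 0) := by
    have h := (tendsto_pow_atTop_nhds_zero_of_lt_one (r := (1 / 2 : ℝ)) (by norm_num)
      (by norm_num)).const_mul B
    rw [mul_zero] at h
    refine h.congr fun n => ?_
    obtain ⟨k, rfl⟩ := Nat.exists_eq_add_of_le' hk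
    rw [Nat.add_sub_cancel, mul_add, mul_one, pow_add, ← pow_mul, mul_comm k n, one_div, inv_pow]
    field_simp
  have hsum := hmain.add herr
  rw [add_zero] at hsum
  refine tendsto_of_tendsto_of_tendsto_of_le_of_le hmain hsum (fun n => ?_) fun n => ?_
  · exact mul_le_mul_of_nonneg_left (card_cubicVanishing_bounds n k).1 (by positivity)
  · simp only [← mul_add]
    exact mul_le_mul_of_nonneg_left (card_cubicVanishing_bounds n k).2 (by positivity)

/-- the (2k)-th moment of `gap(f)` over uniform `f ∈ 𝓕ₙ`, scaled by `2^{-nk}`,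
converges to the Gaussian moment `(2k−1)!! = ∏_{i=1}^{k}(2i−1)`. -/
theorem stmt1 (k : ℕ) (hk : 1 ≤ k) (ε : ℝ) (hε : 0 < ε) :
    ∃ n₀ : ℕ, ∀ n : ℕ, n > n₀ →
      |((2 : ℝ) ^ (n * k))⁻¹ *
          ((∑ α : Coeffs n, ((gap (polyFun α) : ℝ)) ^ (2 * k)) / (Fintype.card (Coeffs n))) -
        ∏ i ∈ Finset.range k, (2 * (i : ℝ) + 1)| ≤ ε := by
  obtain ⟨n₀, h⟩ := Metric.tendsto_atTop.1 (tendsto_card_cubicVanishing k hk) ε hε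
  refine ⟨n₀, fun n hn => ?_⟩
  rw [moment_gap_eq_card]
  exact (h n hn.le).le
end

section
/- For every n ≥ 1, the fraction of f ∈ 𝓕ₙ (uniform distribution) satisfying gap(f)² ≥ 2^{n−1} (equivalently (gap(f)/2ⁿ)² ≥ 2^{−n−1}) is at least 1/12. -/
/-- The sign `(−1)^a` of an element of `𝔽₂`. -/
def signZMod2 (a : ZMod 2) : ℤ := if a = 0 then 1 else -1

lemma signZMod2_add (a b : ZMod 2) : signZMod2 (a + b) = signZMod2 a * signZMod2 b := by
  revert a b; decide

lemma gap_eq_sum_signZMod2 {σ : Type*} [Fintype σ] (f : σ → ZMod 2) :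
    gap f = ∑ x, signZMod2 (f x) := rfl

lemma gap_sq {σ : Type*} [Fintype σ] (f : σ → ZMod 2) :
    gap f ^ 2 = ∑ p : σ × σ, signZMod2 (f p.1 + f p.2) := by
  simp only [gap_eq_sum_signZMod2, sq, Finset.sum_mul_sum, Fintype.sum_prod_type, signZMod2_add]

lemma gap_pow_four {σ : Type*} [Fintype σ] (f : σ → ZMod 2) :
    (gap f ^ 2) ^ 2 =
      ∑ p : (σ × σ) × (σ × σ), signZMod2 ((f p.1.1 + f p.1.2) + (f p.2.1 + f p.2.2)) := by
  rw [gap_sq, sq, Finset.sum_mul_sum, ← Fintype.sum_prod_type']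
  simp only [signZMod2_add]

/-- Orthogonality of characters on `𝔽₂^ι`. -/
lemma sum_signZMod2_dotProduct {ι : Type*} [Fintype ι] [DecidableEq ι] (c : ι → ZMod 2) :
    ∑ α : ι → ZMod 2, signZMod2 (∑ i, α i * c i) =
      if c = 0 then (Fintype.card (ι → ZMod 2) : ℤ) else 0 := by
  split_ifs with h
  · subst h
    simp [signZMod2]
  · obtain ⟨i, hi⟩ := Function.ne_iff.mp h
    have hi1 : c i = 1 := by
      have key : ∀ a : ZMod 2, a ≠ 0 → a = 1 := by decide
      exact key _ hi
    have flip : ∑ α : ι → ZMod 2, signZMod2 (∑ j, α j * c j) =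
        ∑ α : ι → ZMod 2, -signZMod2 (∑ j, α j * c j) := by
      rw [← Equiv.sum_comp (Equiv.addRight (Pi.single i (1 : ZMod 2)))]
      refine Finset.sum_congr rfl fun α _ => ?_
      have : ∑ j, (Pi.single i (1 : ZMod 2) : ι → ZMod 2) j * c j = 1 := by
        simp [Pi.single_apply, hi1]
      simp only [Equiv.coe_addRight, Pi.add_apply, add_mul, Finset.sum_add_distrib, this,
        signZMod2_add]
      simp [signZMod2]
    rw [Finset.sum_neg_distrib] at flip
    linarith

/-- The values at `x` of all nonconstant monomials of degree at most 3. -/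
def monVec {n : ℕ} (x : Fin n → ZMod 2) : MonIdx n → ZMod 2 := fun S => ∏ i ∈ S.1, x i

lemma polyFun_eq {n : ℕ} (α : Coeffs n) (x : Fin n → ZMod 2) :
    polyFun α x = ∑ S, α S * monVec x S := rfl

lemma monVec_injective {n : ℕ} : Function.Injective (monVec (n := n)) := by
  intro x y h
  ext1 i
  simpa [monVec] using congrFun h ⟨{i}, by simp, by simp⟩

lemma monVec_add_self {n : ℕ} (x : Fin n → ZMod 2) : monVec x + monVec x = 0 :=
  funext fun _ => CharTwo.add_self_eq_zero _

lemma monVec_add_eq_zero_iff {n : ℕ} {x y : Fin n → ZMod 2} :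
    monVec x + monVec y = 0 ↔ x = y := by
  rw [← monVec_injective.eq_iff, funext_iff, funext_iff]
  exact forall_congr' fun _ => CharTwo.add_eq_zero

lemma prod_insert_zmod_two {ι : Type*} [DecidableEq ι] (x : ι → ZMod 2) (i : ι) (S : Finset ι) :
    ∏ j ∈ insert i S, x j = x i * ∏ j ∈ S, x j := by
  by_cases h : i ∈ S
  · rw [Finset.insert_eq_of_mem h, ← Finset.mul_prod_erase S x h, ← mul_assoc]
    congr 1
    generalize x i = a
    revert a; decide
  · exact Finset.prod_insert h

/-- Cubic polynomials separate a point from any three others. -/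
lemma mem_of_monVec_sum_eq_zero {n : ℕ} {x y z w : Fin n → ZMod 2}
    (h : monVec x + monVec y + (monVec z + monVec w) = 0) : x = y ∨ x = z ∨ x = w := by
  by_contra! hne
  obtain ⟨i, hi⟩ := Function.ne_iff.mp hne.1
  obtain ⟨j, hj⟩ := Function.ne_iff.mp hne.2.1
  obtain ⟨k, hk⟩ := Function.ne_iff.mp hne.2.2
  have mon1 (a : Fin n) : x a + y a + (z a + w a) = 0 := by
    simpa [monVec] using congrFun h ⟨{a}, by simp, by simp⟩
  have mon2 (a b : Fin n) : x a * x b + y a * y b + (z a * z b + w a * w b) = 0 := by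
    simpa [monVec, prod_insert_zmod_two] using
      congrFun h ⟨{a, b}, by simp, Finset.card_le_two.trans (by norm_num)⟩
  have mon3 (a b c : Fin n) :
      x a * (x b * x c) + y a * (y b * y c) + (z a * (z b * z c) + w a * (w b * w c)) = 0 := by
    simpa [monVec, prod_insert_zmod_two] using
      congrFun h ⟨{a, b, c}, by simp, Finset.card_le_three⟩
  have cubic : (x i - y i) * (x j - z j) * (x k - w k) = 0 := by
    have two : (2 : ZMod 2) = 0 := rfl
    linear_combination mon3 i j k - y i * mon2 j k - z j * mon2 i k - w k * mon2 i j
      + y i * z j * mon1 k + y i * w k * mon1 j + z j * w k * mon1 i - 2 * y i * z j * w k * two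
  simp [sub_eq_zero, hi, hj, hk] at cubic

lemma paired_of_monVec_sum_eq_zero {n : ℕ} {x y z w : Fin n → ZMod 2}
    (h : monVec x + monVec y + (monVec z + monVec w) = 0) :
    x = y ∧ z = w ∨ x = z ∧ y = w ∨ x = w ∧ y = z := by
  rcases mem_of_monVec_sum_eq_zero h with rfl | rfl | rfl
  · rw [monVec_add_self, zero_add] at h
    exact .inl ⟨rfl, monVec_add_eq_zero_iff.mp h⟩
  · rw [add_add_add_comm, monVec_add_self, zero_add] at h
    exact .inr (.inl ⟨rfl, monVec_add_eq_zero_iff.mp h⟩)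
  · rw [add_comm (monVec z), add_add_add_comm, monVec_add_self, zero_add] at h
    exact .inr (.inr ⟨rfl, monVec_add_eq_zero_iff.mp h⟩)

lemma sum_gap_sq (n : ℕ) :
    ∑ α : Coeffs n, gap (polyFun α) ^ 2 = Fintype.card (Coeffs n) * 2 ^ n := by
  simp only [gap_sq]
  rw [Finset.sum_comm]
  simp only [polyFun_eq, ← Finset.sum_add_distrib, ← mul_add, ← Pi.add_apply,
    sum_signZMod2_dotProduct]
  rw [Fintype.sum_prod_type]
  simp [monVec_add_eq_zero_iff, mul_comm]

lemma card_paired_le {σ : Type*} [Fintype σ] [DecidableEq σ] :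
    (Finset.univ.filter fun p : (σ × σ) × (σ × σ) =>
      p.1.1 = p.1.2 ∧ p.2.1 = p.2.2 ∨ p.1.1 = p.2.1 ∧ p.1.2 = p.2.2 ∨
        p.1.1 = p.2.2 ∧ p.1.2 = p.2.1).card ≤ 3 * Fintype.card σ ^ 2 := by
  have card_image (f : σ × σ → (σ × σ) × (σ × σ)) :
      (Finset.univ.image f).card ≤ Fintype.card σ ^ 2 := by
    refine Finset.card_image_le.trans ?_
    simp [sq]
  have cover : (Finset.univ.filter fun p : (σ × σ) × (σ × σ) =>
      p.1.1 = p.1.2 ∧ p.2.1 = p.2.2 ∨ p.1.1 = p.2.1 ∧ p.1.2 = p.2.2 ∨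
        p.1.1 = p.2.2 ∧ p.1.2 = p.2.1) ⊆
      (Finset.univ.image fun q : σ × σ => ((q.1, q.1), (q.2, q.2))) ∪
      ((Finset.univ.image fun q : σ × σ => ((q.1, q.2), (q.1, q.2))) ∪
      (Finset.univ.image fun q : σ × σ => ((q.1, q.2), (q.2, q.1)))) := by
    rintro ⟨⟨x, y⟩, z, w⟩ h
    simp only [Finset.mem_filter, Finset.mem_univ, true_and] at h
    simp only [Finset.mem_union, Finset.mem_image, Finset.mem_univ, true_and, Prod.exists,
      Prod.mk.injEq]
    rcases h with ⟨rfl, rfl⟩ | ⟨rfl, rfl⟩ | ⟨rfl, rfl⟩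
    · exact .inl ⟨x, z, by simp⟩
    · exact .inr (.inl ⟨x, y, by simp⟩)
    · exact .inr (.inr ⟨x, y, by simp⟩)
  have h1 := (Finset.card_le_card cover).trans (Finset.card_union_le _ _)
  have h2 := Finset.card_union_le
    (Finset.univ.image fun q : σ × σ => ((q.1, q.2), (q.1, q.2)))
    (Finset.univ.image fun q : σ × σ => ((q.1, q.2), (q.2, q.1)))
  have h3 := card_image fun q => ((q.1, q.1), (q.2, q.2))
  have h4 := card_image fun q => ((q.1, q.2), (q.1, q.2))
  have h5 := card_image fun q => ((q.1, q.2), (q.2, q.1))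
  omega

lemma sum_gap_pow_four_le (n : ℕ) :
    ∑ α : Coeffs n, (gap (polyFun α) ^ 2) ^ 2 ≤
      Fintype.card (Coeffs n) * (3 * (2 ^ n) ^ 2) := by
  simp only [gap_pow_four]
  rw [Finset.sum_comm]
  simp only [polyFun_eq, ← Finset.sum_add_distrib, ← mul_add, ← Pi.add_apply,
    sum_signZMod2_dotProduct]
  rw [← Finset.sum_filter, Finset.sum_const, nsmul_eq_mul, mul_comm]
  refine mul_le_mul_of_nonneg_left ?_ (Int.natCast_nonneg _)
  have hcard := card_paired_le (σ := Fin n → ZMod 2)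
  rw [Fintype.card_fun, ZMod.card, Fintype.card_fin] at hcard
  refine le_trans ?_ (Int.ofNat_le.mpr hcard)
  refine Int.ofNat_le.mpr (Finset.card_le_card fun p hp => ?_)
  simp only [Finset.mem_filter, Finset.mem_univ, true_and] at hp ⊢
  exact paired_of_monVec_sum_eq_zero hp

/-- The Paley–Zygmund inequality at half the mean, for the uniform distribution on a finite type
and a function of mean `N` whose second moment is at most `3 * N ^ 2`. -/
lemma card_le_twelve_mul_card_filter {ι : Type*} [Fintype ι] (X : ι → ℤ) {N : ℤ} (hN : 0 < N)
    (h1 : ∑ i, X i = Fintype.card ι * N)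
    (h2 : ∑ i, X i ^ 2 ≤ Fintype.card ι * (3 * N ^ 2)) :
    (Fintype.card ι : ℤ) ≤ 12 * (Finset.univ.filter fun i => N ≤ 2 * X i).card := by
  have pointwise (i : ι) :
      12 * N * X i ≤ 6 * N ^ 2 + X i ^ 2 + 36 * N ^ 2 * (if N ≤ 2 * X i then 1 else 0) := by
    split_ifs with h
    · nlinarith [sq_nonneg (X i - 6 * N)]
    · nlinarith [sq_nonneg (X i)]
  have total := Finset.sum_le_sum fun i (_ : i ∈ Finset.univ) => pointwise i
  rw [← Finset.mul_sum, Finset.sum_add_distrib, Finset.sum_add_distrib, Finset.sum_const,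
    ← Finset.mul_sum, h1, Finset.sum_boole, Finset.card_univ, nsmul_eq_mul] at total
  have hN2 : 0 < 3 * N ^ 2 := by positivity
  refine le_of_mul_le_mul_left ?_ hN2
  linarith

/-- for every `n ≥ 1`, the fraction of `f ∈ 𝓕ₙ` with `gap(f)² ≥ 2^{n−1}`
is at least `1/12`. -/
theorem stmt9 (n : ℕ) (hn : 1 ≤ n) :
    (1 : ℚ) / 12 ≤
      ((Finset.univ.filter
          (fun α : Coeffs n => 2 ^ (n - 1) ≤ (gap (polyFun α)) ^ 2)).card : ℚ) /
        (Fintype.card (Coeffs n)) := by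
  have hpow : (2 : ℤ) ^ n = 2 * 2 ^ (n - 1) := by
    rw [← pow_succ', Nat.sub_add_cancel hn]
  have key := card_le_twelve_mul_card_filter (fun α : Coeffs n => gap (polyFun α) ^ 2)
    (N := 2 ^ n) (by positivity) (sum_gap_sq n) (sum_gap_pow_four_le n)
  simp only [hpow, mul_le_mul_iff_right₀ (zero_lt_two' ℤ)] at key
  rw [div_le_div_iff₀ (by norm_num) (by exact_mod_cast Fintype.card_pos), one_mul, mul_comm]
  exact_mod_cast key
end

section
/- There exists n₀ such that for all n > n₀, the fraction of f ∈ 𝓕ₙ (uniform distribution) satisfying gap(f)² ≤ 2^{n−2} (equivalently (gap(f)/2ⁿ)² ≤ 2^{−n−2}) is at least 0.12. -/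
open Module Filter
open scoped Pointwise

/-- The code spanned by the all-ones word and the coordinate words of a tuple of points. -/
def tupleCode {n k : ℕ} (x : Fin k → Fin n → ZMod 2) : Submodule (ZMod 2) (Fin k → ZMod 2) :=
  Submodule.span (ZMod 2) (insert 1 (Set.range fun j i => x i j))

/-- A tuple of points annihilating all monomials of degree between 1 and 3. -/
def AnnihilatesCubics {n k : ℕ} (x : Fin k → Fin n → ZMod 2) : Prop :=
  ∀ S : MonIdx n, ∑ i, ∏ j ∈ S.1, x i j = 0

/-- Every point occurs an even number of times in the tuple. -/
def EvenlyCovered {σ : Type*} [DecidableEq σ] {k : ℕ} (x : Fin k → σ) : Prop :=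
  ∀ s, ((Finset.univ.filter fun i => x i = s).card : ZMod 2) = 0

lemma prod_mul_prod_of_idempotent {ι M : Type*} [DecidableEq ι] [CommMonoid M] (f : ι → M)
    (hf : ∀ i, f i * f i = f i) (S T : Finset ι) :
    (∏ i ∈ S, f i) * ∏ i ∈ T, f i = ∏ i ∈ S ∪ T, f i := by
  induction S using Finset.induction_on with
  | empty => simp
  | insert a S ha ih =>
    rw [Finset.prod_insert ha, mul_assoc, ih, Finset.insert_union]
    by_cases h : a ∈ S ∪ T
    · rw [Finset.insert_eq_of_mem h, ← Finset.mul_prod_erase _ _ h, ← mul_assoc, hf]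
    · rw [Finset.prod_insert h]

/-- The sum of the coordinates, as a linear functional. -/
def coordSum (k : ℕ) : (Fin k → ZMod 2) →ₗ[ZMod 2] ZMod 2 := ∑ i, LinearMap.proj i

lemma coordSum_apply {k : ℕ} (v : Fin k → ZMod 2) : coordSum k v = ∑ i, v i := by
  simp [coordSum]

lemma AnnihilatesCubics.coordSum_eq_zero {n k : ℕ} (hk : Even k) {x : Fin k → Fin n → ZMod 2}
    (hx : AnnihilatesCubics x) {v : Fin k → ZMod 2}
    (hv : v ∈ tupleCode x * tupleCode x * tupleCode x) : coordSum k v = 0 := by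
  have key : tupleCode x * tupleCode x * tupleCode x ≤ LinearMap.ker (coordSum k) := by
    unfold tupleCode
    rw [Submodule.span_mul_span, Submodule.span_mul_span, Submodule.span_le]
    have hgen : ∀ g ∈ (insert 1 (Set.range fun j i => x i j) : Set (Fin k → ZMod 2)),
        ∃ S : Finset (Fin n), S.card ≤ 1 ∧ g = ∏ j ∈ S, fun i => x i j := by
      rintro g (rfl | ⟨j, rfl⟩)
      · exact ⟨∅, by simp⟩
      · exact ⟨{j}, by simp⟩
    have hidem : ∀ j, (fun i => x i j) * (fun i => x i j) = fun i => x i j := by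
      intro j
      ext i
      exact (by decide : ∀ a : ZMod 2, a * a = a) (x i j)
    rintro _ ⟨_, ⟨a, ha, b, hb, rfl⟩, c, hc, rfl⟩
    obtain ⟨S, hS, rfl⟩ := hgen a ha
    obtain ⟨T, hT, rfl⟩ := hgen b hb
    obtain ⟨U, hU, rfl⟩ := hgen c hc
    simp only [prod_mul_prod_of_idempotent _ hidem, SetLike.mem_coe, LinearMap.mem_ker,
      coordSum_apply, Finset.prod_apply]
    have hcard : (S ∪ T ∪ U).card ≤ 3 := by
      have := Finset.card_union_le (S ∪ T) U
      have := Finset.card_union_le S T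
      omega
    rcases (S ∪ T ∪ U).eq_empty_or_nonempty with he | hne
    · rw [he]
      simpa using (ZMod.natCast_eq_zero_iff_even).2 hk
    · exact hx ⟨_, hne, hcard⟩
  exact key hv

lemma finrank_add_finrank_le_of_coordSum_mul_eq_zero {k : ℕ}
    (V W : Submodule (ZMod 2) (Fin k → ZMod 2))
    (h : ∀ v ∈ V, ∀ w ∈ W, coordSum k (v * w) = 0) :
    finrank (ZMod 2) V + finrank (ZMod 2) W ≤ k := by
  let B : LinearMap.BilinForm (ZMod 2) (Fin k → ZMod 2) :=
    (LinearMap.mul (ZMod 2) (Fin k → ZMod 2)).compr₂ (coordSum k)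
  have hB : LinearMap.ker B = ⊥ := by
    rw [LinearMap.ker_eq_bot']
    intro v hv
    ext i
    have := LinearMap.congr_fun hv (Pi.single i 1)
    simpa [B, coordSum_apply, Pi.single_apply] using this
  have h1 := LinearMap.BilinForm.finrank_add_finrank_orthogonal' (B := B) V
  rw [hB, inf_bot_eq, finrank_bot, add_zero, finrank_fin_fun] at h1
  have h2 : W ≤ B.orthogonal V := fun w hw v hv => h v hv w hw
  have := Submodule.finrank_mono h2
  omega

theorem AnnihilatesCubics.evenlyCovered {n k : ℕ} (hk : Even k) {x : Fin k → Fin n → ZMod 2}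
    (hx : AnnihilatesCubics x) (hr : k ≤ 2 * finrank (ZMod 2) (tupleCode x)) :
    EvenlyCovered x := by
  have hone : (1 : Fin k → ZMod 2) ∈ tupleCode x := Submodule.subset_span (Set.mem_insert _ _)
  have hle : tupleCode x ≤ tupleCode x * tupleCode x := fun v hv => by
    simpa using Submodule.mul_mem_mul hv hone
  have hdim := finrank_add_finrank_le_of_coordSum_mul_eq_zero (tupleCode x * tupleCode x)
    (tupleCode x) fun v hv w hw => hx.coordSum_eq_zero hk (Submodule.mul_mem_mul hv hw)
  have heq : tupleCode x = tupleCode x * tupleCode x :=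
    Submodule.eq_of_le_of_finrank_le hle (by omega)
  intro s
  have hmem : (∏ j, ((fun i => x i j) + (1 + s j) • (1 : Fin k → ZMod 2))) ∈ tupleCode x := by
    refine Finset.prod_induction _ (· ∈ tupleCode x) (fun a b ha hb => ?_) hone fun j _ => ?_
    · rw [heq]
      exact Submodule.mul_mem_mul ha hb
    · exact add_mem (Submodule.subset_span (Set.mem_insert_of_mem _ ⟨j, rfl⟩))
        (Submodule.smul_mem _ _ hone)
  have hsum := hx.coordSum_eq_zero hk
    (Submodule.mul_mem_mul (Submodule.mul_mem_mul hmem hone) hone)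
  rw [mul_one, mul_one, coordSum_apply] at hsum
  rw [Finset.natCast_card_filter]
  refine Eq.trans ?_ hsum
  refine Finset.sum_congr rfl fun i _ => ?_
  simp only [Finset.prod_apply, Pi.add_apply, Pi.smul_apply, Pi.one_apply, smul_eq_mul, mul_one]
  split_ifs with h
  · rw [Finset.prod_eq_one]
    intro j _
    rw [h]
    exact (by decide : ∀ a : ZMod 2, a + (1 + a) = 1) (s j)
  · obtain ⟨j, hj⟩ := Function.ne_iff.1 h
    rw [Finset.prod_eq_zero (Finset.mem_univ j)]
    exact (by decide : ∀ a b : ZMod 2, a ≠ b → a + (1 + b) = 0) _ _ hj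

/-- The sign `(-1)^a`. -/
def sgn (a : ZMod 2) : ℤ := if a = 0 then 1 else -1

lemma sgn_sum {ι : Type*} (s : Finset ι) (f : ι → ZMod 2) :
    sgn (∑ i ∈ s, f i) = ∏ i ∈ s, sgn (f i) := by
  classical
  induction s using Finset.induction_on with
  | empty => rfl
  | insert a s ha ih =>
    rw [Finset.sum_insert ha, Finset.prod_insert ha, ← ih]
    exact (by decide : ∀ a b : ZMod 2, sgn (a + b) = sgn a * sgn b) _ _

lemma gap_pow {σ : Type*} [Fintype σ] (f : σ → ZMod 2) (k : ℕ) :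
    gap f ^ k = ∑ x : Fin k → σ, sgn (∑ i, f (x i)) := by
  simp only [sgn_sum]
  exact Fintype.sum_pow (fun x => sgn (f x)) k

lemma sum_sgn_linear {ι : Type*} [Fintype ι] [DecidableEq ι] (t : ι → ZMod 2) :
    ∑ α : ι → ZMod 2, sgn (∑ s, α s * t s) =
      if ∀ s, t s = 0 then (Fintype.card (ι → ZMod 2) : ℤ) else 0 := by
  simp only [sgn_sum]
  rw [← Fintype.prod_sum (fun s a => sgn (a * t s))]
  have h : ∀ b : ZMod 2, ∑ a : ZMod 2, sgn (a * b) = if b = 0 then 2 else 0 := by decide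
  simp only [h]
  split_ifs with h0
  · simp [h0]
  · push Not at h0
    obtain ⟨s, hs⟩ := h0
    exact Finset.prod_eq_zero (Finset.mem_univ s) (if_neg hs)

open Classical in
lemma sum_gap_polyFun_pow (n k : ℕ) :
    ∑ α : Coeffs n, gap (polyFun α) ^ k = Fintype.card (Coeffs n) *
      ((Finset.univ.filter fun x : Fin k → Fin n → ZMod 2 => AnnihilatesCubics x).card : ℤ) := by
  simp only [gap_pow]
  rw [Finset.sum_comm, Finset.natCast_card_filter, Finset.mul_sum]
  refine Finset.sum_congr rfl fun x _ => ?_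
  have h : ∀ α : Coeffs n, ∑ i, polyFun α (x i) =
      ∑ S : MonIdx n, α S * ∑ i, ∏ j ∈ S.1, x i j := by
    intro α
    simp only [polyFun, Finset.mul_sum]
    exact Finset.sum_comm
  simp only [h, mul_ite, mul_one, mul_zero]
  exact (sum_sgn_linear _).trans (if_congr Iff.rfl rfl rfl)

open Classical in
lemma sum_gap_pow {σ : Type*} [Fintype σ] [DecidableEq σ] (k : ℕ) :
    ∑ F : σ → ZMod 2, gap F ^ k = Fintype.card (σ → ZMod 2) *
      ((Finset.univ.filter fun x : Fin k → σ => EvenlyCovered x).card : ℤ) := by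
  simp only [gap_pow]
  rw [Finset.sum_comm, Finset.natCast_card_filter, Finset.mul_sum]
  refine Finset.sum_congr rfl fun x _ => ?_
  have h : ∀ F : σ → ZMod 2, ∑ i, F (x i) =
      ∑ s, F s * ((Finset.univ.filter fun i => x i = s).card : ZMod 2) := by
    intro F
    simp only [Finset.natCast_card_filter, Finset.mul_sum]
    rw [Finset.sum_comm]
    simp
  simp only [h, mul_ite, mul_one, mul_zero]
  exact (sum_sgn_linear _).trans (if_congr Iff.rfl rfl rfl)

lemma EvenlyCovered.annihilatesCubics {n k : ℕ} {x : Fin k → Fin n → ZMod 2}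
    (hx : EvenlyCovered x) : AnnihilatesCubics x := by
  intro S
  rw [← Finset.sum_fiberwise Finset.univ x]
  refine Finset.sum_eq_zero fun s _ => ?_
  rw [Finset.sum_congr rfl (g := fun _ => ∏ j ∈ S.1, s j)
    fun i hi => by rw [(Finset.mem_filter.1 hi).2]]
  rw [Finset.sum_const, nsmul_eq_mul, hx s, zero_mul]

open Classical in
/-- Tuples spanning a code of small dimension are rare. -/
lemma card_finrank_tupleCode_lt (k m : ℕ) : ∃ K : ℕ, ∀ n : ℕ,
    (Finset.univ.filter fun x : Fin k → Fin n → ZMod 2 =>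
      finrank (ZMod 2) (tupleCode x) < m).card * 2 ^ n ≤ K * (2 ^ n) ^ m := by
  let _ : Fintype (Submodule (ZMod 2) (Fin k → ZMod 2)) := Fintype.ofFinite _
  let P := Finset.univ.filter fun C : Submodule (ZMod 2) (Fin k → ZMod 2) =>
    finrank (ZMod 2) C < m
  refine ⟨P.card, fun n => ?_⟩
  have hsub : (Finset.univ.filter fun x : Fin k → Fin n → ZMod 2 =>
      finrank (ZMod 2) (tupleCode x) < m) ⊆ P.biUnion fun C =>
        Finset.univ.filter fun x : Fin k → Fin n → ZMod 2 => ∀ j, (fun i => x i j) ∈ C := by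
    intro x hx
    simp only [Finset.mem_filter, Finset.mem_univ, true_and, Finset.mem_biUnion, P] at hx ⊢
    exact ⟨_, hx, fun j => Submodule.subset_span (Set.mem_insert_of_mem _ ⟨j, rfl⟩)⟩
  have hC : ∀ C ∈ P, (Finset.univ.filter fun x : Fin k → Fin n → ZMod 2 =>
      ∀ j, (fun i => x i j) ∈ C).card * 2 ^ n ≤ (2 ^ n) ^ m := by
    intro C hC
    simp only [Finset.mem_filter, Finset.mem_univ, true_and, P] at hC
    have h1 : (Finset.univ.filter fun x : Fin k → Fin n → ZMod 2 =>
        ∀ j, (fun i => x i j) ∈ C).card ≤ Fintype.card (Fin n → C) := by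
      rw [← Fintype.card_subtype]
      refine Fintype.card_le_of_injective (fun x j => ⟨fun i => x.1 i j, x.2 j⟩) ?_
      intro x y hxy
      ext i j
      have := congrArg Subtype.val (congrFun hxy j)
      exact congrFun this i
    have h2 : Fintype.card C = 2 ^ finrank (ZMod 2) C := by
      rw [Module.card_eq_pow_finrank (K := ZMod 2) (V := C), ZMod.card]
    rw [Fintype.card_fun, h2, Fintype.card_fin] at h1
    calc _ ≤ (2 ^ finrank (ZMod 2) C) ^ n * 2 ^ n := Nat.mul_le_mul_right _ h1
      _ = (2 ^ n) ^ (finrank (ZMod 2) C + 1) := by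
        rw [← pow_mul, mul_comm, pow_succ, ← pow_mul, mul_comm (2 ^ n), mul_comm n]
      _ ≤ (2 ^ n) ^ m := Nat.pow_le_pow_right (by positivity) hC
  calc _ ≤ (∑ C ∈ P, (Finset.univ.filter fun x : Fin k → Fin n → ZMod 2 =>
        ∀ j, (fun i => x i j) ∈ C).card) * 2 ^ n :=
        Nat.mul_le_mul_right _ ((Finset.card_le_card hsub).trans Finset.card_biUnion_le)
    _ ≤ ∑ C ∈ P, (2 ^ n) ^ m := by
        rw [Finset.sum_mul]
        exact Finset.sum_le_sum hC
    _ = _ := by rw [Finset.sum_const, smul_eq_mul]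

/-- The `k`-th moment of the sum of `N` independent signs. -/
noncomputable def signMoment (N k : ℕ) : ℝ :=
  (∑ F : Fin N → ZMod 2, (gap F : ℝ) ^ k) / 2 ^ N

lemma sum_gap_pow_eq_signMoment {σ : Type*} [Fintype σ] [DecidableEq σ] (k : ℕ) :
    ∑ F : σ → ZMod 2, (gap F : ℝ) ^ k =
      Fintype.card (σ → ZMod 2) * signMoment (Fintype.card σ) k := by
  have e := Fintype.equivFin σ
  have h : ∑ F : σ → ZMod 2, (gap F : ℝ) ^ k =
      ∑ F : Fin (Fintype.card σ) → ZMod 2, (gap F : ℝ) ^ k := by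
    refine Fintype.sum_equiv (e.arrowCongr (Equiv.refl _)) _ _ fun F => ?_
    have : gap F = gap (e.arrowCongr (Equiv.refl _) F) :=
      Fintype.sum_equiv e _ _ fun s => by simp [Equiv.arrowCongr]
    rw [this]
  rw [h, signMoment, Fintype.card_fun, ZMod.card]
  push_cast
  field_simp

lemma gap_insertNth {N : ℕ} (i : Fin (N + 1)) (b : ZMod 2) (F : Fin N → ZMod 2) :
    gap (i.insertNth b F : Fin (N + 1) → ZMod 2) = sgn b + gap F := by
  unfold gap
  rw [Fin.sum_univ_succAbove _ i]
  simp [sgn]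

lemma sum_sgn_mul_gap_pow {N : ℕ} (i : Fin (N + 1)) (k : ℕ) :
    ∑ F : Fin (N + 1) → ZMod 2, (sgn (F i) : ℝ) * (gap F : ℝ) ^ k =
      ∑ F : Fin N → ZMod 2, ((1 + (gap F : ℝ)) ^ k - (-1 + (gap F : ℝ)) ^ k) := by
  rw [← (Fin.insertNthEquiv (fun _ => ZMod 2) i).sum_comp, Fintype.sum_prod_type, Finset.sum_comm]
  refine Finset.sum_congr rfl fun F _ => ?_
  have h : ∀ g : ZMod 2 → ℝ, ∑ b, g b = g 0 + g 1 := Fin.sum_univ_two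
  rw [h]
  simp [Fin.insertNthEquiv, gap_insertNth, show sgn 0 = 1 from rfl, show sgn 1 = -1 from rfl,
    sub_eq_add_neg]

lemma signMoment_succ (N m : ℕ) : signMoment (N + 1) (2 * m + 2) =
    (N + 1) * ∑ j ∈ Finset.range (m + 1),
      ((2 * m + 1).choose (2 * j) : ℝ) * signMoment N (2 * j) := by
  have hexp : ∀ S : ℝ, (1 + S) ^ (2 * m + 1) - (-1 + S) ^ (2 * m + 1) =
      2 * ∑ j ∈ Finset.range (m + 1), ((2 * m + 1).choose (2 * j) : ℝ) * S ^ (2 * j) := by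
    intro S
    have hr : ∀ f : ℕ → ℝ, ∑ j ∈ Finset.range (2 * m + 2), f j =
        ∑ j ∈ Finset.range (m + 1), (f (2 * j) + f (2 * j + 1)) := by
      intro f
      induction m with
      | zero => simp [Finset.sum_range_succ]
      | succ m ih =>
        rw [Finset.sum_range_succ _ (m + 1), ← ih, show 2 * (m + 1) + 2 = 2 * m + 2 + 1 + 1 by ring,
          Finset.sum_range_succ, Finset.sum_range_succ]
        ring_nf
    rw [add_comm 1 S, add_comm (-1) S, add_pow, add_pow, ← Finset.sum_sub_distrib, hr,
      Finset.mul_sum]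
    refine Finset.sum_congr rfl fun j hj => ?_
    have hj : j ≤ m := by simpa [Nat.lt_succ_iff] using hj
    rw [show 2 * m + 1 - 2 * j = 2 * (m - j) + 1 by omega,
      show 2 * m + 1 - (2 * j + 1) = 2 * (m - j) by omega]
    simp [pow_succ, pow_mul]
    ring
  have hN : ∑ F : Fin (N + 1) → ZMod 2, (gap F : ℝ) ^ (2 * m + 2) = (N + 1) *
      ∑ F : Fin N → ZMod 2, ((1 + (gap F : ℝ)) ^ (2 * m + 1) - (-1 + (gap F : ℝ)) ^ (2 * m + 1)) := by
    have : ∀ F : Fin (N + 1) → ZMod 2, (gap F : ℝ) ^ (2 * m + 2) =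
        ∑ i, (sgn (F i) : ℝ) * (gap F : ℝ) ^ (2 * m + 1) := by
      intro F
      rw [← Finset.sum_mul, pow_succ' _ (2 * m + 1)]
      simp [gap, sgn]
    simp only [this]
    rw [Finset.sum_comm]
    simp only [sum_sgn_mul_gap_pow]
    simp [mul_sub]
  rw [signMoment, hN]
  simp only [hexp, signMoment]
  rw [← Finset.mul_sum, Finset.sum_comm]
  simp only [← Finset.mul_sum, ← mul_div_assoc, ← Finset.sum_div]
  rw [pow_succ]
  field_simp

open scoped Nat in
lemma tendsto_signMoment_div (m : ℕ) :
    Tendsto (fun N : ℕ => signMoment N (2 * m) / (N : ℝ) ^ m) atTop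
      (nhds ((2 * m - 1)‼ : ℝ)) := by
  induction m using Nat.strong_induction_on with
  | _ m ih =>
  rcases m with _ | m
  · have : ∀ N : ℕ, signMoment N 0 = 1 := fun N => by simp [signMoment]
    simp [this]
  rw [← tendsto_add_atTop_iff_nat 1]
  have hq : Tendsto (fun N : ℕ => (N : ℝ) / (N + 1)) atTop (nhds 1) :=
    tendsto_natCast_div_add_atTop 1
  have hi : Tendsto (fun N : ℕ => 1 / ((N : ℝ) + 1)) atTop (nhds 0) :=
    tendsto_one_div_add_atTop_nhds_zero_nat
  have hterm : ∀ j ∈ Finset.range (m + 1), Tendsto (fun N : ℕ =>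
      ((2 * m + 1).choose (2 * j) : ℝ) * ((signMoment N (2 * j) / (N : ℝ) ^ j) *
        ((N : ℝ) / (N + 1)) ^ j * (1 / ((N : ℝ) + 1)) ^ (m - j))) atTop
      (nhds (((2 * m + 1).choose (2 * j) : ℝ) * (((2 * j - 1)‼ : ℝ) * 1 ^ j * 0 ^ (m - j)))) := by
    intro j hj
    exact (((ih j (Finset.mem_range.1 hj)).mul (hq.pow j)).mul (hi.pow (m - j))).const_mul _
  have hsum := tendsto_finsetSum _ hterm
  have hlim : ∑ j ∈ Finset.range (m + 1),
      ((2 * m + 1).choose (2 * j) : ℝ) * (((2 * j - 1)‼ : ℝ) * 1 ^ j * 0 ^ (m - j)) =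
      ((2 * (m + 1) - 1)‼ : ℝ) := by
    rw [Finset.sum_range_succ, Finset.sum_eq_zero]
    · rw [show 2 * (m + 1) - 1 = 2 * m + 1 by omega, Nat.doubleFactorial_add_one,
        Nat.choose_succ_self_right]
      simp
    · intro j hj
      have : m - j ≠ 0 := by have := Finset.mem_range.1 hj; omega
      simp [this]
  rw [hlim] at hsum
  refine hsum.congr' ?_
  filter_upwards [eventually_gt_atTop 0] with N hN
  have hN' : (0 : ℝ) < N := by exact_mod_cast hN
  rw [show 2 * (m + 1) = 2 * m + 2 by ring, signMoment_succ, Finset.mul_sum, Finset.sum_div]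
  refine Finset.sum_congr rfl fun j hj => ?_
  have hj : j ≤ m := by simpa [Nat.lt_succ_iff] using hj
  obtain ⟨l, rfl⟩ := Nat.exists_eq_add_of_le hj
  rw [Nat.add_sub_cancel_left]
  push_cast
  rw [div_pow, div_pow, one_pow, pow_succ, pow_add]
  field_simp

/-- The `m`-th moment of `gap(f)² / 2ⁿ` over the polynomials `f` of degree at most 3. -/
noncomputable def cubicMoment (n m : ℕ) : ℝ :=
  (∑ α : Coeffs n, ((gap (polyFun α) : ℝ) ^ 2 / 2 ^ n) ^ m) / Fintype.card (Coeffs n)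

open Classical in
lemma cubicMoment_eq_card (n m : ℕ) : cubicMoment n m =
    (Finset.univ.filter fun x : Fin (2 * m) → Fin n → ZMod 2 => AnnihilatesCubics x).card /
      (2 ^ n : ℝ) ^ m := by
  have h : (∑ α : Coeffs n, (gap (polyFun α) : ℝ) ^ (2 * m)) = Fintype.card (Coeffs n) *
      ((Finset.univ.filter fun x : Fin (2 * m) → Fin n → ZMod 2 =>
        AnnihilatesCubics x).card : ℝ) := by
    exact_mod_cast sum_gap_polyFun_pow n (2 * m)
  have hc : (Fintype.card (Coeffs n) : ℝ) ≠ 0 := by exact_mod_cast Fintype.card_ne_zero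
  simp only [cubicMoment, div_pow, ← pow_mul _ 2 m]
  rw [← Finset.sum_div, h]
  field_simp

open Classical in
lemma signMoment_eq_card (n k : ℕ) : signMoment (2 ^ n) k =
    (Finset.univ.filter fun x : Fin k → Fin n → ZMod 2 => EvenlyCovered x).card := by
  have h : (∑ F : (Fin n → ZMod 2) → ZMod 2, (gap F : ℝ) ^ k) =
      Fintype.card ((Fin n → ZMod 2) → ZMod 2) *
      ((Finset.univ.filter fun x : Fin k → Fin n → ZMod 2 => EvenlyCovered x).card : ℝ) := by
    exact_mod_cast sum_gap_pow (σ := Fin n → ZMod 2) k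
  have hc : (Fintype.card ((Fin n → ZMod 2) → ZMod 2) : ℝ) ≠ 0 := by
    exact_mod_cast Fintype.card_ne_zero
  rw [sum_gap_pow_eq_signMoment] at h
  simpa [ZMod.card] using mul_left_cancel₀ hc h

/-- The moments of `gap(f)² / 2ⁿ` exceed those for uniformly random Boolean functions by at most
`O(2⁻ⁿ)`. -/
lemma exists_cubicMoment_bounds (m : ℕ) : ∃ K : ℝ, ∀ n : ℕ,
    signMoment (2 ^ n) (2 * m) / (2 ^ n : ℝ) ^ m ≤ cubicMoment n m ∧
    cubicMoment n m ≤ signMoment (2 ^ n) (2 * m) / (2 ^ n : ℝ) ^ m + K * (1 / 2) ^ n := by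
  classical
  obtain ⟨K, hK⟩ := card_finrank_tupleCode_lt (2 * m) m
  refine ⟨K, fun n => ?_⟩
  rw [cubicMoment_eq_card, signMoment_eq_card]
  constructor
  · gcongr
    exact EvenlyCovered.annihilatesCubics
  · have hsub : (Finset.univ.filter fun x : Fin (2 * m) → Fin n → ZMod 2 => AnnihilatesCubics x) ⊆
        (Finset.univ.filter fun x => EvenlyCovered x) ∪
        Finset.univ.filter fun x => finrank (ZMod 2) (tupleCode x) < m := by
      intro x hx
      simp only [Finset.mem_filter, Finset.mem_univ, true_and, Finset.mem_union] at hx ⊢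
      by_cases h : finrank (ZMod 2) (tupleCode x) < m
      · exact Or.inr h
      · exact Or.inl (hx.evenlyCovered (even_two_mul m) (by omega))
    have h1 := (Finset.card_le_card hsub).trans (Finset.card_union_le _ _)
    have h1' : ((Finset.univ.filter fun x : Fin (2 * m) → Fin n → ZMod 2 =>
        AnnihilatesCubics x).card : ℝ) ≤ (Finset.univ.filter fun x : Fin (2 * m) → Fin n → ZMod 2 =>
        EvenlyCovered x).card + (Finset.univ.filter fun x : Fin (2 * m) → Fin n → ZMod 2 =>
        finrank (ZMod 2) (tupleCode x) < m).card := by exact_mod_cast h1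
    have h2 : ((Finset.univ.filter fun x : Fin (2 * m) → Fin n → ZMod 2 =>
        finrank (ZMod 2) (tupleCode x) < m).card : ℝ) * 2 ^ n ≤ K * (2 ^ n) ^ m := by
      exact_mod_cast hK n
    have hp : (0 : ℝ) < (2 ^ n) ^ m := by positivity
    have h2n : (0 : ℝ) < 2 ^ n := by positivity
    rw [div_le_iff₀ hp, add_mul, div_mul_cancel₀ _ hp.ne']
    refine h1'.trans ((add_le_add_iff_left _).2 ?_)
    rw [div_pow, one_pow, mul_one_div, div_mul_eq_mul_div, le_div_iff₀ h2n]
    exact h2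

open scoped Nat in
lemma tendsto_cubicMoment (m : ℕ) :
    Tendsto (fun n => cubicMoment n m) atTop (nhds ((2 * m - 1)‼ : ℝ)) := by
  obtain ⟨K, hK⟩ := exists_cubicMoment_bounds m
  have h : Tendsto (fun n : ℕ => signMoment (2 ^ n) (2 * m) / (2 ^ n : ℝ) ^ m) atTop
      (nhds ((2 * m - 1)‼ : ℝ)) := by
    simpa [Function.comp_def] using
      (tendsto_signMoment_div m).comp (tendsto_pow_atTop_atTop_of_one_lt (one_lt_two (α := ℕ)))
  refine tendsto_of_tendsto_of_tendsto_of_le_of_le h ?_ (fun n => (hK n).1) fun n => (hK n).2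
  have h0 : Tendsto (fun n : ℕ => ((1 : ℝ) / 2) ^ n) atTop (nhds 0) :=
    tendsto_pow_atTop_nhds_zero_of_lt_one (by norm_num) (by norm_num)
  simpa using h.add (h0.const_mul K)

/-- The coefficients of the polynomial `∏ i, (1 - bᵢ x)` in `smallGapPoly_eq_prod`. -/
noncomputable def smallGapCoeff : Fin 7 → ℝ :=
  ![1, -541 / 500, 45529 / 125000, -25960721 / 500000000, 3443332251 / 1000000000000,
    -5184788913 / 50000000000000, 2266273647 / 2000000000000000]

lemma smallGapPoly_eq_prod (x : ℝ) : ∑ i, smallGapCoeff i * x ^ (i : ℕ) =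
    (1 - 61 / 100 * x) * (1 - 225 / 1000 * x) * (1 - 113 / 1000 * x) * (1 - 66 / 1000 * x) *
      (1 - 41 / 1000 * x) * (1 - 27 / 1000 * x) := by
  simp [smallGapCoeff, Fin.sum_univ_succ]
  ring

/-- A polynomial minorant on `[0, ∞)` of the indicator function of `[0, 1/4]`. -/
noncomputable def smallGapMinorant (x : ℝ) : ℝ :=
  (1 - 4 * x) * (∑ i, smallGapCoeff i * x ^ (i : ℕ)) ^ 2

lemma smallGapMinorant_nonpos {x : ℝ} (hx : 1 / 4 ≤ x) : smallGapMinorant x ≤ 0 :=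
  mul_nonpos_of_nonpos_of_nonneg (by linarith) (sq_nonneg _)

lemma smallGapMinorant_le_one {x : ℝ} (h0 : 0 ≤ x) (hx : x ≤ 1 / 4) : smallGapMinorant x ≤ 1 := by
  have hfac : ∀ b : ℝ, 0 ≤ b → b ≤ 1 → 0 ≤ 1 - b * x ∧ 1 - b * x ≤ 1 := fun b hb hb1 =>
    ⟨by nlinarith, by nlinarith⟩
  have hmul : ∀ a b : ℝ, (0 ≤ a ∧ a ≤ 1) → (0 ≤ b ∧ b ≤ 1) → 0 ≤ a * b ∧ a * b ≤ 1 :=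
    fun a b ha hb => ⟨mul_nonneg ha.1 hb.1, mul_le_one₀ ha.2 hb.1 hb.2⟩
  have hp : 0 ≤ ∑ i, smallGapCoeff i * x ^ (i : ℕ) ∧
      ∑ i, smallGapCoeff i * x ^ (i : ℕ) ≤ 1 := by
    rw [smallGapPoly_eq_prod]
    refine hmul _ _ (hmul _ _ (hmul _ _ (hmul _ _ (hmul _ _ ?_ ?_) ?_) ?_) ?_) ?_ <;>
      exact hfac _ (by norm_num) (by norm_num)
  exact mul_le_one₀ (by linarith) (sq_nonneg _) (pow_le_one₀ hp.1 hp.2)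

lemma smallGapMinorant_eq_sum (x : ℝ) : smallGapMinorant x = ∑ i, ∑ j,
    smallGapCoeff i * smallGapCoeff j * (x ^ (i + j : ℕ) - 4 * x ^ (i + j + 1 : ℕ)) := by
  rw [smallGapMinorant, sq, Finset.sum_mul_sum, Finset.mul_sum]
  refine Finset.sum_congr rfl fun i _ => ?_
  rw [Finset.mul_sum]
  refine Finset.sum_congr rfl fun j _ => ?_
  ring

lemma sum_smallGapMinorant_div_card (n : ℕ) :
    (∑ α : Coeffs n, smallGapMinorant ((gap (polyFun α) : ℝ) ^ 2 / 2 ^ n)) /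
      Fintype.card (Coeffs n) = ∑ i, ∑ j, smallGapCoeff i * smallGapCoeff j *
        (cubicMoment n (i + j) - 4 * cubicMoment n (i + j + 1)) := by
  simp only [smallGapMinorant_eq_sum]
  rw [Finset.sum_comm, Finset.sum_div]
  refine Finset.sum_congr rfl fun i _ => ?_
  rw [Finset.sum_comm, Finset.sum_div]
  refine Finset.sum_congr rfl fun j _ => ?_
  rw [← Finset.mul_sum, Finset.sum_sub_distrib, ← Finset.mul_sum, cubicMoment, cubicMoment]
  ring

open scoped Nat in
lemma lt_sum_smallGapCoeff_mul_doubleFactorial : (12 : ℝ) / 100 < ∑ i, ∑ j,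
    smallGapCoeff i * smallGapCoeff j *
      (((2 * (i + j : ℕ) - 1)‼ : ℝ) - 4 * ((2 * (i + j + 1 : ℕ) - 1)‼ : ℝ)) := by
  simp [smallGapCoeff, Fin.sum_univ_succ, Nat.doubleFactorial]
  norm_num

lemma sum_smallGapMinorant_le_card {n : ℕ} (hn : 2 ≤ n) :
    ∑ α : Coeffs n, smallGapMinorant ((gap (polyFun α) : ℝ) ^ 2 / 2 ^ n) ≤
      (Finset.univ.filter fun α : Coeffs n => gap (polyFun α) ^ 2 ≤ 2 ^ (n - 2)).card := by
  rw [Finset.natCast_card_filter]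
  refine Finset.sum_le_sum fun α _ => ?_
  have h4 : (2 : ℝ) ^ n = 4 * 2 ^ (n - 2) := by
    obtain ⟨m, rfl⟩ := Nat.exists_eq_add_of_le' hn
    rw [Nat.add_sub_cancel, pow_add]
    ring
  have hp : (0 : ℝ) < 2 ^ (n - 2) := by positivity
  split_ifs with h
  · have h' : (gap (polyFun α) : ℝ) ^ 2 ≤ 2 ^ (n - 2) := by exact_mod_cast h
    refine smallGapMinorant_le_one (by positivity) ?_
    rw [h4, div_le_iff₀ (by positivity)]
    linarith
  · have h' : (2 : ℝ) ^ (n - 2) ≤ (gap (polyFun α) : ℝ) ^ 2 := by exact_mod_cast (not_le.1 h).le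
    refine smallGapMinorant_nonpos ?_
    rw [h4, le_div_iff₀ (by positivity)]
    linarith

/-- for all sufficiently large `n`, the fraction of `f ∈ 𝓕ₙ` with
`gap(f)² ≤ 2^{n−2}` is at least `0.12`. -/
theorem stmt10 :
    ∃ n₀ : ℕ, ∀ n : ℕ, n > n₀ →
      (12 : ℚ) / 100 ≤
        ((Finset.univ.filter
            (fun α : Coeffs n => (gap (polyFun α)) ^ 2 ≤ 2 ^ (n - 2))).card : ℚ) /
          (Fintype.card (Coeffs n)) := by
  have hlim := tendsto_finsetSum Finset.univ fun (i : Fin 7) _ =>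
    tendsto_finsetSum Finset.univ fun (j : Fin 7) _ =>
      ((tendsto_cubicMoment (i + j)).sub
        ((tendsto_cubicMoment (i + j + 1)).const_mul 4)).const_mul
          (smallGapCoeff i * smallGapCoeff j)
  obtain ⟨n₀, hn₀⟩ := eventually_atTop.1
    (hlim.eventually_const_lt lt_sum_smallGapCoeff_mul_doubleFactorial)
  refine ⟨n₀ + 2, fun n hn => ?_⟩
  have h := hn₀ n (by omega)
  rw [← sum_smallGapMinorant_div_card] at h
  have hle := h.le.trans (div_le_div_of_nonneg_right
    (sum_smallGapMinorant_le_card (n := n) (by omega)) (Nat.cast_nonneg _))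
  rw [← Rat.cast_le (K := ℝ)]
  push_cast
  exact hle
end

section
/- For every n ≥ 1, the fraction of f ∈ 𝓕ₙ (uniform distribution) belonging to 𝓕ₙ^prom, i.e. satisfying gap(f)² ≥ 2^{n−1} or gap(f)² ≤ 2^{n−2}, is at least 1/5. -/
open Finset

/-- The evaluation of polynomials is additive in the coefficients. -/
theorem polyFun_add {n : ℕ} (α β : Coeffs n) (z : Fin n → ZMod 2) :
    polyFun (α + β) z = polyFun α z + polyFun β z := by
  simp [polyFun, add_mul, sum_add_distrib]

theorem add_self_coeffs {n : ℕ} (α : Coeffs n) : α + α = 0 :=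
  funext fun S => CharTwo.add_self_eq_zero (α S)

/-- The gap splits along the first variable. -/
theorem gap_cons {m : ℕ} (f : (Fin (m + 1) → ZMod 2) → ZMod 2) :
    gap f = gap (fun y => f (Fin.cons 0 y)) + gap (fun y => f (Fin.cons 1 y)) := by
  unfold gap
  rw [← (Fin.consEquiv (fun _ : Fin (m + 1) => ZMod 2)).sum_comp, Fintype.sum_prod_type]
  exact Fin.sum_univ_two (fun b : Fin 2 => ∑ y : Fin m → ZMod 2,
    if f (Fin.cons (α := fun _ => ZMod 2) (b : ZMod 2) y) = 0 then (1 : ℤ) else -1)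

/-- Complementing a Boolean function negates its gap. -/
theorem gap_add_one {σ : Type*} [Fintype σ] (f : σ → ZMod 2) :
    gap (fun x => f x + 1) = -gap f := by
  unfold gap
  rw [← sum_neg_distrib]
  have h : ∀ v : ZMod 2, (if v + 1 = 0 then (1 : ℤ) else -1) = -if v = 0 then 1 else -1 := by
    decide
  exact sum_congr rfl fun x _ => h (f x)

/-- Adding a constant to a Boolean function changes its gap at most by a sign. -/
theorem gap_add_const {σ : Type*} [Fintype σ] (κ : ZMod 2) :
    ∃ ε : ℤ, ε ^ 2 = 1 ∧ ∀ f : σ → ZMod 2, gap (fun x => f x + κ) = ε * gap f := by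
  have h : κ = 0 ∨ κ = 1 := by revert κ; decide
  rcases h with rfl | rfl
  · exact ⟨1, by norm_num, fun f => by simp⟩
  · exact ⟨-1, by norm_num, fun f => by simp [gap_add_one]⟩

/-- The monomial consisting of the first variable. -/
def firstVar (m : ℕ) : MonIdx (m + 1) := ⟨{0}, by simp⟩

/-- The part of a polynomial which is divisible by the first variable. -/
def firstVarPart {m : ℕ} (α : Coeffs (m + 1)) : Coeffs (m + 1) :=
  fun S => if 0 ∈ S.1 then α S else 0

/-- The derivative of a polynomial in the direction of the first variable, without its
constant term. -/
def firstDeriv {m : ℕ} (α : Coeffs (m + 1)) : Coeffs (m + 1) :=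
  fun S => if h : 0 ∉ S.1 ∧ (insert 0 S.1).card ≤ 3 then
    α ⟨insert 0 S.1, insert_nonempty _ _, h.2⟩ else 0

theorem firstVarPart_add {m : ℕ} (α β : Coeffs (m + 1)) :
    firstVarPart (α + β) = firstVarPart α + firstVarPart β := by
  ext S
  by_cases h : 0 ∈ S.1 <;> simp [firstVarPart, h]

theorem firstDeriv_add {m : ℕ} (α β : Coeffs (m + 1)) :
    firstDeriv (α + β) = firstDeriv α + firstDeriv β := by
  ext S
  by_cases h : 0 ∉ S.1 ∧ (insert 0 S.1).card ≤ 3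
  · simp only [firstDeriv, dif_pos h, Pi.add_apply]
  · simp only [firstDeriv, dif_neg h, Pi.add_apply, add_zero]

theorem firstDeriv_firstDeriv {m : ℕ} (α : Coeffs (m + 1)) :
    firstDeriv (firstDeriv α) = 0 := by
  ext S
  simp [firstDeriv]

theorem polyFun_firstVarPart {m : ℕ} (α : Coeffs (m + 1)) (y : Fin m → ZMod 2) (b : ZMod 2) :
    polyFun (firstVarPart α) (Fin.cons b y) =
      polyFun α (Fin.cons b y) + polyFun α (Fin.cons 0 y) := by
  unfold polyFun
  rw [← sum_add_distrib]
  refine sum_congr rfl fun S _ => ?_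
  by_cases h : 0 ∈ S.1
  · have h0 : ∏ i ∈ S.1, (Fin.cons 0 y : Fin (m + 1) → ZMod 2) i = 0 :=
      prod_eq_zero h (by simp)
    simp [firstVarPart, h, h0]
  · have h0 : ∏ i ∈ S.1, (Fin.cons b y : Fin (m + 1) → ZMod 2) i =
        ∏ i ∈ S.1, (Fin.cons 0 y : Fin (m + 1) → ZMod 2) i := by
      refine prod_congr rfl fun i hi => ?_
      obtain ⟨j, rfl⟩ := Fin.exists_succ_eq.2 (fun e : i = 0 => h (e ▸ hi))
      simp
    simp [firstVarPart, h, h0, CharTwo.add_self_eq_zero]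

theorem polyFun_single_firstVar {m : ℕ} (κ b : ZMod 2) (y : Fin m → ZMod 2) :
    polyFun (Pi.single (firstVar m) κ) (Fin.cons b y) = κ * b := by
  unfold polyFun
  rw [sum_eq_single (firstVar m)]
  · simp [firstVar]
  · intro S _ hS
    simp [hS]
  · simp

theorem polyFun_firstDeriv {m : ℕ} (α : Coeffs (m + 1)) (y : Fin m → ZMod 2) (b : ZMod 2) :
    polyFun (firstDeriv α) (Fin.cons b y) =
      polyFun α (Fin.cons 1 y) + polyFun α (Fin.cons 0 y) + α (firstVar m) := by
  have key : polyFun (firstVarPart α) (Fin.cons 1 y) =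
      α (firstVar m) + polyFun (firstDeriv α) (Fin.cons b y) := by
    unfold polyFun
    rw [← add_sum_erase univ _ (mem_univ (firstVar m))]
    congr 1
    · simp [firstVarPart, firstVar]
    · rw [← sum_filter_of_ne (p := fun S : MonIdx (m + 1) => 0 ∈ S.1),
        ← sum_filter_of_ne (s := univ)
          (p := fun S : MonIdx (m + 1) => 0 ∉ S.1 ∧ (insert 0 S.1).card ≤ 3)]
      · symm
        refine sum_bij' (fun S hS => ⟨insert 0 S.1, insert_nonempty _ _,
            (mem_filter.1 hS).2.2⟩)
          (fun S hS => ⟨S.1.erase 0, ?_, (card_le_card (erase_subset _ _)).trans S.2.2⟩)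
          ?_ ?_ ?_ ?_ ?_
        · rw [mem_filter, mem_erase] at hS
          rw [nonempty_iff_ne_empty, Ne, erase_eq_empty_iff]
          rintro (h | h)
          · exact S.2.1.ne_empty h
          · exact hS.1.1 (Subtype.ext h)
        · intro S hS
          have h0 := (mem_filter.1 hS).2.1
          rw [mem_filter, mem_erase]
          refine ⟨⟨fun e => ?_, mem_univ _⟩, mem_insert_self _ _⟩
          obtain ⟨i, hi⟩ := S.2.1
          have e' : insert 0 S.1 = {0} := congrArg Subtype.val e
          have hi' : i ∈ ({0} : Finset (Fin (m + 1))) := e' ▸ mem_insert_of_mem hi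
          exact h0 (mem_singleton.1 hi' ▸ hi)
        · intro S hS
          have h0 := (mem_filter.1 hS).2
          simpa [insert_erase h0] using S.2.2
        · intro S hS
          exact Subtype.ext (erase_insert (mem_filter.1 hS).2.1)
        · intro S hS
          exact Subtype.ext (insert_erase (mem_filter.1 hS).2)
        · intro S hS
          have h0 := (mem_filter.1 hS).2
          have hp : ∏ i ∈ insert 0 S.1, (Fin.cons 1 y : Fin (m + 1) → ZMod 2) i =
              ∏ i ∈ S.1, (Fin.cons b y : Fin (m + 1) → ZMod 2) i := by
            rw [prod_insert h0.1, Fin.cons_zero, one_mul]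
            refine prod_congr rfl fun i hi => ?_
            obtain ⟨j, rfl⟩ := Fin.exists_succ_eq.2 (fun e : i = 0 => h0.1 (e ▸ hi))
            simp
          simp only [hp]
          simp only [firstDeriv, firstVarPart, dif_pos h0, if_pos (mem_insert_self _ _)]
      · intro S _ hS
        by_contra h
        exact hS (by simp only [firstDeriv, dif_neg h, zero_mul])
      · intro S _ hS
        by_contra h
        exact hS (by simp only [firstVarPart, if_neg h, zero_mul])
  rw [← polyFun_firstVarPart, key, add_comm (α _), add_assoc, CharTwo.add_self_eq_zero, add_zero]

/-- A polynomial whose gap is, up to sign, the difference of the gaps of `α` and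
`α + firstVarPart β`. -/
def gapDiff {m : ℕ} (α β : Coeffs (m + 1)) : Coeffs (m + 1) :=
  α + firstVarPart α + firstDeriv α + firstVarPart β + Pi.single (firstVar m) 1

theorem gap_gapDiff_sq {m : ℕ} (α β : Coeffs (m + 1)) :
    gap (polyFun (gapDiff α β)) ^ 2 =
      (gap (polyFun α) - gap (polyFun (α + firstVarPart β))) ^ 2 := by
  obtain ⟨ε, hε, hg⟩ := gap_add_const (σ := Fin m → ZMod 2) (α (firstVar m))
  have two (v : ZMod 2) : v + v = 0 := CharTwo.add_self_eq_zero v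
  have h0 : (fun y : Fin m → ZMod 2 => polyFun (gapDiff α β) (Fin.cons 0 y)) =
      fun y => polyFun α (Fin.cons 1 y) + α (firstVar m) := by
    ext y
    simp only [gapDiff, polyFun_add, polyFun_firstVarPart, polyFun_firstDeriv,
      polyFun_single_firstVar]
    linear_combination 2 * two (polyFun α (Fin.cons 0 y)) + two (polyFun β (Fin.cons 0 y))
  have h1 : (fun y : Fin m → ZMod 2 => polyFun (gapDiff α β) (Fin.cons 1 y)) =
      fun y => polyFun (α + firstVarPart β) (Fin.cons 1 y) + 1 + α (firstVar m) := by
    ext y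
    simp only [gapDiff, polyFun_add, polyFun_firstVarPart, polyFun_firstDeriv,
      polyFun_single_firstVar]
    linear_combination two (polyFun α (Fin.cons 0 y)) + two (polyFun α (Fin.cons 1 y))
  have h2 : (fun y : Fin m → ZMod 2 => polyFun (α + firstVarPart β) (Fin.cons 0 y)) =
      fun y => polyFun α (Fin.cons 0 y) := by
    ext y
    rw [polyFun_add, polyFun_firstVarPart, two, add_zero]
  rw [gap_cons (polyFun (gapDiff α β)), gap_cons (polyFun α),
    gap_cons (polyFun (α + firstVarPart β)), h0, h1, h2, hg, hg, gap_add_one]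
  linear_combination (gap (fun y : Fin m → ZMod 2 => polyFun α (Fin.cons 1 y)) -
    gap (fun y : Fin m → ZMod 2 => polyFun (α + firstVarPart β) (Fin.cons 1 y))) ^ 2 * hε

/-- Two integers and their difference cannot all have squares in an interval `(b, 2b)`. -/
theorem sq_sub_not_mem_Ioo {b x y : ℤ} (hx : x ^ 2 ∈ Set.Ioo b (2 * b))
    (hy : y ^ 2 ∈ Set.Ioo b (2 * b)) : (x - y) ^ 2 ∉ Set.Ioo b (2 * b) := by
  rintro ⟨h1, h2⟩
  obtain ⟨hx1, hx2⟩ := hx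
  obtain ⟨hy1, hy2⟩ := hy
  rcases le_total (x * y) 0 with h | h
  · nlinarith
  rcases le_total (y * (x - y)) 0 with h' | h'
  · nlinarith
  · nlinarith

/-- Adding to a polynomial its derivative in the first variable is an involution. -/
theorem add_firstDeriv_involutive {m : ℕ} :
    Function.Involutive (fun α : Coeffs (m + 1) => α + firstDeriv α) := by
  intro α
  simp only [firstDeriv_add, firstDeriv_firstDeriv, add_zero]
  rw [add_assoc, add_self_coeffs, add_zero]

theorem sum_add_firstVarPart {m : ℕ} (F : Coeffs (m + 1) → ℕ) :
    ∑ α, ∑ β, F (α + firstVarPart β) = Fintype.card (Coeffs (m + 1)) * ∑ α, F α := by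
  rw [sum_comm]
  rw [← smul_eq_mul, ← card_univ, ← sum_const]
  exact sum_congr rfl fun β _ => Equiv.sum_comp (Equiv.addRight (firstVarPart β)) F

theorem sum_gapDiff {m : ℕ} (F : Coeffs (m + 1) → ℕ) :
    ∑ α, ∑ β, F (gapDiff α β) = Fintype.card (Coeffs (m + 1)) * ∑ α, F α := by
  have h (α : Coeffs (m + 1)) : ∑ β, F (gapDiff α β) =
      ∑ β, F (α + firstDeriv α + (firstVarPart β + Pi.single (firstVar m) 1)) := by
    rw [← Equiv.sum_comp (Equiv.addLeft α) (fun β => F (gapDiff α β))]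
    refine sum_congr rfl fun β _ => congrArg F ?_
    have two := add_self_coeffs (firstVarPart α)
    simp only [Equiv.coe_addLeft, gapDiff, firstVarPart_add]
    linear_combination two
  simp_rw [h]
  rw [sum_comm, ← smul_eq_mul, ← card_univ, ← sum_const]
  refine sum_congr rfl fun β _ => ?_
  have hshift := Equiv.sum_comp (Equiv.addRight (firstVarPart β + Pi.single (firstVar m) 1)) F
  have hinv := Equiv.sum_comp (add_firstDeriv_involutive (m := m)).toPerm
    (fun γ => F (γ + (firstVarPart β + Pi.single (firstVar m) 1)))
  exact hinv.trans hshift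

/-- At most two thirds of the polynomials have a squared gap in a given interval `(b, 2b)`. -/
theorem three_mul_card_gap_sq_mem_Ioo_le {m : ℕ} (b : ℤ) :
    3 * #{α : Coeffs (m + 1) | gap (polyFun α) ^ 2 ∈ Set.Ioo b (2 * b)} ≤
      2 * Fintype.card (Coeffs (m + 1)) := by
  classical
  set F : Coeffs (m + 1) → ℕ := fun α =>
    if gap (polyFun α) ^ 2 ∈ Set.Ioo b (2 * b) then 1 else 0 with hF
  have hsum : ∑ α, ∑ β, (F α + F (α + firstVarPart β) + F (gapDiff α β)) ≤
      ∑ _α : Coeffs (m + 1), ∑ _β : Coeffs (m + 1), 2 := by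
    refine sum_le_sum fun α _ => sum_le_sum fun β _ => ?_
    have h := sq_sub_not_mem_Ioo (b := b) (x := gap (polyFun α))
      (y := gap (polyFun (α + firstVarPart β)))
    rw [← gap_gapDiff_sq] at h
    simp only [hF]
    split_ifs with h1 h2 h3 <;> first | omega | exact absurd h3 (h h1 h2)
  simp only [sum_add_distrib, sum_gapDiff, sum_add_firstVarPart, sum_const, card_univ,
    smul_eq_mul, ← mul_sum] at hsum
  rw [card_filter]
  have hpos : 0 < Fintype.card (Coeffs (m + 1)) := Fintype.card_pos
  refine Nat.le_of_mul_le_mul_left ?_ hpos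
  change _ * (3 * ∑ α, F α) ≤ _
  linarith

/-- for every `n ≥ 1`, the fraction of `f ∈ 𝓕ₙ` satisfying the promise
(`gap(f)² ≥ 2^{n−1}` or `gap(f)² ≤ 2^{n−2}`) is at least `1/5`. -/
theorem stmt11 (n : ℕ) (hn : 1 ≤ n) :
    (1 : ℚ) / 5 ≤
      ((Finset.univ.filter
          (fun α : Coeffs n =>
            2 ^ (n - 1) ≤ (gap (polyFun α)) ^ 2 ∨
              (gap (polyFun α)) ^ 2 ≤ 2 ^ (n - 2))).card : ℚ) /
        (Fintype.card (Coeffs n)) := by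
  classical
  obtain ⟨m, rfl⟩ : ∃ m, n = m + 1 := ⟨n - 1, by omega⟩
  have hb : (2 : ℤ) ^ (m + 1 - 1) ≤ 2 * 2 ^ (m + 1 - 2) := by
    rw [← pow_succ']
    exact pow_le_pow_right₀ (by norm_num) (by omega)
  have hbad := three_mul_card_gap_sq_mem_Ioo_le (m := m) (2 ^ (m + 1 - 2))
  have hsplit := card_filter_add_card_filter_not (s := univ) (fun α : Coeffs (m + 1) =>
    2 ^ (m + 1 - 1) ≤ (gap (polyFun α)) ^ 2 ∨ (gap (polyFun α)) ^ 2 ≤ 2 ^ (m + 1 - 2))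
  have hle : #{α : Coeffs (m + 1) | ¬(2 ^ (m + 1 - 1) ≤ (gap (polyFun α)) ^ 2 ∨
      (gap (polyFun α)) ^ 2 ≤ 2 ^ (m + 1 - 2))} ≤
      #{α : Coeffs (m + 1) | gap (polyFun α) ^ 2 ∈
        Set.Ioo ((2 : ℤ) ^ (m + 1 - 2)) (2 * 2 ^ (m + 1 - 2))} := by
    refine card_le_card (monotone_filter_right _ fun α _ h => ?_)
    exact ⟨not_le.1 (not_or.1 h).2, (not_le.1 (not_or.1 h).1).trans_le hb⟩
  rw [card_univ] at hsplit
  have hgood : Fintype.card (Coeffs (m + 1)) ≤ 5 * #{α : Coeffs (m + 1) |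
      2 ^ (m + 1 - 1) ≤ (gap (polyFun α)) ^ 2 ∨
        (gap (polyFun α)) ^ 2 ≤ 2 ^ (m + 1 - 2)} := by omega
  have hcast := Nat.cast_le (α := ℚ).2 hgood
  rw [Nat.cast_mul] at hcast
  rw [div_le_div_iff₀ (by norm_num) (Nat.cast_pos.2 Fintype.card_pos), one_mul, mul_comm]
  exact hcast
end
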